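/- Under assumptions (B1'), (MT0'), (MT1'), (MT2') and (GT'), the family of recentered maxima distributions {F_n(· − Med(F_n))}_{n≥0} is tight: for every ε > 0 there exists K > 0 such that for all n ≥ 0, F_n(Med(F_n) + K) − F_n(Med(F_n) − K) ≥ 1 − ε. -/

import Mathlib

open MeasureTheory Set Filter

namespace BRW

/-! ### Elementary product inequalities -/

lemma prod_one_sub_mem {ι : Type*} (s : Finset ι) (a : ι → ℝ) (ha : ∀ i, a i ∈ Icc (0:ℝ) 1) :
    (∏ i ∈ s, (1 - a i)) ∈ Icc (0:ℝ) 1 := by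
  constructor
  · exact Finset.prod_nonneg fun i _ => by linarith [(ha i).2]
  · exact Finset.prod_le_one (fun i _ => by linarith [(ha i).2]) (fun i _ => by linarith [(ha i).1])

lemma prod_one_sub_anti {ι : Type*} (s : Finset ι) (a b : ι → ℝ) (hb : ∀ i, b i ≤ 1)
    (hab : ∀ i, a i ≤ b i) :
    (∏ i ∈ s, (1 - b i)) ≤ ∏ i ∈ s, (1 - a i) :=
  Finset.prod_le_prod (fun i _ => by linarith [hb i]) (fun i _ => by linarith [hab i])

lemma one_sub_sum_le_prod {ι : Type*} (s : Finset ι) (a : ι → ℝ) (ha : ∀ i, a i ∈ Icc (0:ℝ) 1) :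
    1 - ∑ i ∈ s, a i ≤ ∏ i ∈ s, (1 - a i) := by
  classical
  induction s using Finset.induction_on with
  | empty => simp
  | insert j s hj ih =>
    rw [Finset.sum_insert hj, Finset.prod_insert hj]
    have h1 := prod_one_sub_mem s a ha
    have h2 := ha j
    nlinarith [h1.1, h1.2, h2.1, h2.2, mul_nonneg h2.1 (sub_nonneg.2 h1.2)]

lemma prod_diff_le {ι : Type*} (s : Finset ι) (a b w : ι → ℝ) (ha : ∀ i, a i ∈ Icc (0:ℝ) 1)
    (hb : ∀ i, b i ∈ Icc (0:ℝ) 1) (hw : ∀ i, 0 ≤ w i) (h : ∀ i, b i ≤ a i + w i) :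
    (∏ i ∈ s, (1 - a i)) - (∏ i ∈ s, (1 - b i)) ≤ ∑ i ∈ s, w i := by
  classical
  induction s using Finset.induction_on with
  | empty => simp
  | insert j s hj ih =>
    rw [Finset.sum_insert hj, Finset.prod_insert hj, Finset.prod_insert hj]
    have h1 := prod_one_sub_mem s a ha
    have h2 := ha j
    have h3 := prod_one_sub_mem s b hb
    have h4 := hb j
    have h5 := Finset.sum_nonneg (s := s) (fun i _ => hw i)
    set A := ∏ i ∈ s, (1 - a i)
    set B := ∏ i ∈ s, (1 - b i)
    set W := ∑ i ∈ s, w i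
    have e : (1 - a j) * A - (1 - b j) * B = (1 - b j) * (A - B) + (b j - a j) * A := by ring
    rw [e]
    have e1 : (1 - b j) * (A - B) ≤ (1 - b j) * W :=
      mul_le_mul_of_nonneg_left ih (by linarith [h4.2])
    have e2 : (1 - b j) * W ≤ W := by nlinarith [h4.1]
    have e3 : (b j - a j) * A ≤ w j * A := mul_le_mul_of_nonneg_right (by linarith [h j]) h1.1
    have e4 : w j * A ≤ w j := by nlinarith [hw j, h1.2]
    linarith

lemma prod_diff_ge {ι : Type*} (s : Finset ι) (a b : ι → ℝ) (ha : ∀ i, a i ∈ Icc (0:ℝ) 1)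
    (hb : ∀ i, b i ∈ Icc (0:ℝ) 1) (h : ∀ i, a i ≤ b i) :
    (∑ i ∈ s, (b i - a i)) * (1 - ∑ i ∈ s, b i) ≤
      (∏ i ∈ s, (1 - a i)) - (∏ i ∈ s, (1 - b i)) := by
  classical
  induction s using Finset.induction_on with
  | empty => simp
  | insert j s hj ih =>
    have hm := prod_one_sub_anti (insert j s) a b (fun i => (hb i).2) h
    have hD : 0 ≤ ∑ i ∈ insert j s, (b i - a i) :=
      Finset.sum_nonneg fun i _ => by linarith [h i]
    by_cases hc : 1 - ∑ i ∈ insert j s, b i ≤ 0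
    · have := mul_nonpos_of_nonneg_of_nonpos hD hc
      linarith
    push Not at hc
    rw [Finset.sum_insert hj] at hc ⊢
    rw [Finset.sum_insert hj, Finset.prod_insert hj, Finset.prod_insert hj]
    have h1 := one_sub_sum_le_prod s a ha
    have h4 := hb j
    have h5 : ∑ i ∈ s, a i ≤ ∑ i ∈ s, b i := Finset.sum_le_sum fun i _ => h i
    have hD' : 0 ≤ ∑ i ∈ s, (b i - a i) := Finset.sum_nonneg fun i _ => by linarith [h i]
    have hB' : 0 ≤ ∑ i ∈ s, b i := Finset.sum_nonneg fun i _ => (hb i).1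
    set A := ∏ i ∈ s, (1 - a i)
    set B := ∏ i ∈ s, (1 - b i)
    set D := ∑ i ∈ s, (b i - a i)
    set Bs := ∑ i ∈ s, b i
    have e : (1 - a j) * A - (1 - b j) * B = (1 - b j) * (A - B) + (b j - a j) * A := by ring
    rw [e]
    have e1 : (1 - b j) * (D * (1 - Bs)) ≤ (1 - b j) * (A - B) :=
      mul_le_mul_of_nonneg_left ih (by linarith [h4.2])
    have e2 : (b j - a j) * (1 - Bs) ≤ (b j - a j) * A :=
      mul_le_mul_of_nonneg_left (by linarith) (by linarith [h j])
    have e3 : 0 ≤ D * (b j * Bs) := mul_nonneg hD' (mul_nonneg h4.1 hB')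
    have e4 : 0 ≤ (b j - a j) * b j := mul_nonneg (by linarith [h j]) h4.1
    nlinarith

lemma prod_diff_ge_sq {k : ℕ} (a b : Fin k → ℝ) (c : ℝ) (hc : 0 ≤ c)
    (ha : ∀ i, a i ∈ Icc (0:ℝ) 1)
    (hb : ∀ i, b i ∈ Icc (0:ℝ) 1) (h : ∀ i, a i ≤ b i) (hcb : ∀ i, b i - a i ≤ c * b i) :
    (∑ i, (b i - a i)) - c * k * ∑ i, (b i) ^ 2 ≤
      (∏ i, (1 - a i)) - (∏ i, (1 - b i)) := by
  have h1 := prod_diff_ge Finset.univ a b ha hb h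
  have h2 : (∑ i, b i) ^ 2 ≤ (k : ℝ) * ∑ i, (b i) ^ 2 := by
    have := sq_sum_le_card_mul_sum_sq (s := (Finset.univ : Finset (Fin k))) (f := b)
    simpa using this
  have h3 : ∑ i, (b i - a i) ≤ c * ∑ i, b i := by
    rw [Finset.mul_sum]; exact Finset.sum_le_sum fun i _ => hcb i
  have hB' : 0 ≤ ∑ i, b i := Finset.sum_nonneg fun i _ => (hb i).1
  have h4 : (∑ i, (b i - a i)) * (∑ i, b i) ≤ c * (∑ i, b i) * (∑ i, b i) :=
    mul_le_mul_of_nonneg_right h3 hB'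
  have h5 := mul_le_mul_of_nonneg_left h2 hc
  nlinarith

lemma prod_diff_one {k : ℕ} (v T w : Fin (k+1) → ℝ) (b : ℝ)
    (hv : ∀ i, v i ∈ Icc (0:ℝ) 1) (hT : ∀ i, T i ∈ Icc (0:ℝ) 1) (hw : ∀ i, 0 ≤ w i)
    (hb : ∀ i, v i ≤ b) (h : ∀ i, v i + w i ≤ T i) :
    (1 - b * ((k + 1 : ℕ) : ℝ)) * w 0 ≤ (∏ i, (1 - v i)) - (∏ i, (1 - T i)) := by
  have hb0 : 0 ≤ b := (hv 0).1.trans (hb 0)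
  have hvT : ∀ i, v i ≤ T i := fun i => by linarith [h i, hw i]
  have hm := prod_one_sub_anti Finset.univ v T (fun i => (hT i).2) hvT
  by_cases hc : 1 - b * ((k + 1 : ℕ) : ℝ) ≤ 0
  · have := mul_nonpos_of_nonneg_of_nonpos (hw 0) hc
    linarith
  push Not at hc
  rw [Fin.prod_univ_succ, Fin.prod_univ_succ]
  have h1 := one_sub_sum_le_prod (Finset.univ : Finset (Fin k)) (fun i => v i.succ) (fun i => hv _)
  have h2 := prod_one_sub_anti (Finset.univ : Finset (Fin k)) (fun i => v i.succ)
    (fun i => T i.succ) (fun i => (hT _).2) (fun i => hvT _)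
  have h3 : ∑ i : Fin k, v i.succ ≤ k * b := by
    calc ∑ i : Fin k, v i.succ ≤ ∑ i : Fin k, b := Finset.sum_le_sum fun i _ => hb _
      _ = k * b := by simp
  set A := ∏ i : Fin k, (1 - v i.succ)
  set B := ∏ i : Fin k, (1 - T i.succ)
  push_cast at hc ⊢
  have e1 : (1 - T 0) * B ≤ (1 - T 0) * A :=
    mul_le_mul_of_nonneg_left h2 (by linarith [(hT 0).2])
  have e2 : (1 - b * (k + 1)) * w 0 ≤ A * w 0 := mul_le_mul_of_nonneg_right (by linarith) (hw 0)
  have e3 : w 0 * A ≤ (T 0 - v 0) * A :=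
    mul_le_mul_of_nonneg_right (by linarith [h 0]) (by linarith)
  nlinarith

/-! ### One generation -/

/-- measurable functions with values in `[0,1]` -/
def Nice (h : ℝ → ℝ) : Prop := Measurable h ∧ ∀ y, h y ∈ Icc (0:ℝ) 1

/-- contribution of `k` offspring -/
noncomputable def J (k : ℕ) (G : Measure (Fin k → ℝ)) (h : ℝ → ℝ) : ℝ :=
  ∫ y, (1 - ∏ i, (1 - h (y i))) ∂G

lemma integrable_bdd {α : Type*} [MeasurableSpace α] (μ : Measure α) [IsProbabilityMeasure μ]
    (f : α → ℝ) (hf : Measurable f) (C : ℝ) (hC : ∀ x, |f x| ≤ C) : Integrable f μ :=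
  Integrable.of_bound hf.aestronglyMeasurable C (Filter.Eventually.of_forall hC)

lemma Nice.integrable {h : ℝ → ℝ} (hh : Nice h) (γ : Measure ℝ) [IsProbabilityMeasure γ] :
    Integrable h γ :=
  integrable_bdd γ h hh.1 1 fun x => abs_le.2 ⟨by linarith [(hh.2 x).1], (hh.2 x).2⟩

lemma measurable_prodf {k : ℕ} {h : ℝ → ℝ} (hh : Measurable h) :
    Measurable (fun y : Fin k → ℝ => 1 - ∏ i, (1 - h (y i))) := by
  fun_prop

lemma Nice.integrable_prod {h : ℝ → ℝ} (hh : Nice h) {k : ℕ} (G : Measure (Fin k → ℝ))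
    [IsProbabilityMeasure G] :
    Integrable (fun y : Fin k → ℝ => 1 - ∏ i, (1 - h (y i))) G := by
  refine integrable_bdd G _ (measurable_prodf hh.1) 1 fun y => ?_
  have := prod_one_sub_mem Finset.univ (fun i => h (y i)) (fun i => hh.2 _)
  rw [abs_le]; constructor <;> linarith [this.1, this.2]

lemma integral_coord {k : ℕ} (G : Measure (Fin k → ℝ)) (γ : Measure ℝ)
    (hm : ∀ i : Fin k, G.map (fun y => y i) = γ) (f : ℝ → ℝ) (hf : Measurable f) (i : Fin k) :
    ∫ y, f (y i) ∂G = ∫ y, f y ∂γ := by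
  rw [← hm i, integral_map (measurable_pi_apply i).aemeasurable hf.aestronglyMeasurable]

lemma integrable_coord {k : ℕ} (G : Measure (Fin k → ℝ)) [IsProbabilityMeasure G]
    (f : ℝ → ℝ) (hf : Measurable f) (C : ℝ) (hC : ∀ x, |f x| ≤ C) (i : Fin k) :
    Integrable (fun y : Fin k → ℝ => f (y i)) G :=
  integrable_bdd G _ (hf.comp (measurable_pi_apply i)) C fun _ => hC _

lemma integral_sum_coord {k : ℕ} (G : Measure (Fin k → ℝ)) [IsProbabilityMeasure G] (γ : Measure ℝ)
    (hm : ∀ i : Fin k, G.map (fun y => y i) = γ) (f : ℝ → ℝ) (hf : Measurable f)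
    (C : ℝ) (hC : ∀ x, |f x| ≤ C) :
    ∫ y, ∑ i, f (y i) ∂G = k * ∫ y, f y ∂γ := by
  rw [integral_finsetSum _ fun i _ => integrable_coord G f hf C hC i]
  simp [integral_coord G γ hm f hf]

lemma J_mem {k : ℕ} (G : Measure (Fin k → ℝ)) [IsProbabilityMeasure G] {h : ℝ → ℝ} (hh : Nice h) :
    J k G h ∈ Icc (0:ℝ) 1 := by
  have hb : ∀ y : Fin k → ℝ, 1 - ∏ i, (1 - h (y i)) ∈ Icc (0:ℝ) 1 := fun y => by
    have := prod_one_sub_mem Finset.univ (fun i => h (y i)) (fun i => hh.2 _)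
    exact ⟨by linarith [this.2], by linarith [this.1]⟩
  constructor
  · exact integral_nonneg fun y => (hb y).1
  · calc J k G h ≤ ∫ y, (1:ℝ) ∂G :=
        integral_mono (hh.integrable_prod G) (integrable_const _) fun y => (hb y).2
      _ = 1 := by simp

lemma J_mono {k : ℕ} (G : Measure (Fin k → ℝ)) [IsProbabilityMeasure G] {h v : ℝ → ℝ}
    (hh : Nice h) (hv : Nice v) (hhv : ∀ y, h y ≤ v y) : J k G h ≤ J k G v := by
  refine integral_mono (hh.integrable_prod G) (hv.integrable_prod G) fun y => ?_
  have := prod_one_sub_anti Finset.univ (fun i => h (y i)) (fun i => v (y i)) (fun i => (hv.2 _).2)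
    (fun i => hhv _)
  simp only at this ⊢
  linarith

lemma J_sub {k : ℕ} (G : Measure (Fin k → ℝ)) [IsProbabilityMeasure G] {h v : ℝ → ℝ}
    (hh : Nice h) (hv : Nice v) :
    J k G v - J k G h = ∫ y, ((∏ i, (1 - h (y i))) - ∏ i, (1 - v (y i))) ∂G := by
  unfold J
  rw [← integral_sub (hv.integrable_prod G) (hh.integrable_prod G)]
  congr 1; ext y; ring

lemma integrable_diff {k : ℕ} (G : Measure (Fin k → ℝ)) [IsProbabilityMeasure G] {h v : ℝ → ℝ}
    (hh : Nice h) (hv : Nice v) :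
    Integrable (fun y : Fin k → ℝ => (∏ i, (1 - h (y i))) - ∏ i, (1 - v (y i))) G := by
  have := (hv.integrable_prod G).sub (hh.integrable_prod G)
  refine this.congr (Filter.Eventually.of_forall fun y => ?_)
  simp only [Pi.sub_apply]; ring

lemma J_union {k : ℕ} (G : Measure (Fin k → ℝ)) [IsProbabilityMeasure G] (γ : Measure ℝ)
    (hm : ∀ i : Fin k, G.map (fun y => y i) = γ) {h v w : ℝ → ℝ}
    (hh : Nice h) (hv : Nice v) (hw : Nice w) (hle : ∀ y, v y ≤ h y + w y) :
    J k G v ≤ J k G h + k * ∫ y, w y ∂γ := by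
  have hwb : ∀ x, |w x| ≤ 1 := fun x => abs_le.2 ⟨by linarith [(hw.2 x).1], (hw.2 x).2⟩
  have h1 := J_sub G hh hv
  have h2 := integral_sum_coord G γ hm w hw.1 1 hwb
  have h3 : ∫ y, ((∏ i, (1 - h (y i))) - ∏ i, (1 - v (y i))) ∂G ≤ ∫ y, ∑ i, w (y i) ∂G :=
    integral_mono (integrable_diff G hh hv)
      (integrable_finsetSum _ fun i _ => integrable_coord G w hw.1 1 hwb i) fun y =>
      prod_diff_le Finset.univ (fun i => h (y i)) (fun i => v (y i)) (fun i => w (y i))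
        (fun i => hh.2 _) (fun i => hv.2 _) (fun i => (hw.2 _).1) (fun i => hle _)
  linarith

lemma J_lower {k : ℕ} (G : Measure (Fin k → ℝ)) [IsProbabilityMeasure G] (γ : Measure ℝ)
    [IsProbabilityMeasure γ]
    (hm : ∀ i : Fin k, G.map (fun y => y i) = γ) {h v : ℝ → ℝ} (c : ℝ) (hc : 0 ≤ c)
    (hh : Nice h) (hv : Nice v) (hle : ∀ y, h y ≤ v y) (hcv : ∀ y, v y - h y ≤ c * v y) :
    J k G h + (k * ∫ y, (v y - h y) ∂γ - c * (k:ℝ)^2 * ∫ y, (v y)^2 ∂γ) ≤ J k G v := by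
  have h1 := J_sub G hh hv
  have hd : ∀ x, |v x - h x| ≤ 1 := fun x =>
    abs_le.2 ⟨by linarith [hle x], by linarith [(hv.2 x).2, (hh.2 x).1]⟩
  have hs : ∀ x, |(v x)^2| ≤ 1 := fun x => by
    rw [abs_of_nonneg (sq_nonneg _)]; nlinarith [(hv.2 x).1, (hv.2 x).2]
  have h2 := integral_sum_coord G γ hm (fun y => v y - h y) (hv.1.sub hh.1) 1 hd
  have h2' := integral_sum_coord G γ hm (fun y => (v y)^2) (hv.1.pow_const 2) 1 hs
  have i1 : Integrable (fun y : Fin k → ℝ => ∑ i, (v (y i) - h (y i))) G :=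
    integrable_finsetSum _ fun i _ =>
      integrable_coord G (fun y => v y - h y) (hv.1.sub hh.1) 1 hd i
  have i2 : Integrable (fun y : Fin k → ℝ => ∑ i, (v (y i))^2) G :=
    integrable_finsetSum _ fun i _ =>
      integrable_coord G (fun y => (v y)^2) (hv.1.pow_const 2) 1 hs i
  have h3 : ∫ y, ((∑ i, (v (y i) - h (y i))) - c * k * ∑ i, (v (y i))^2) ∂G ≤
      ∫ y, ((∏ i, (1 - h (y i))) - ∏ i, (1 - v (y i))) ∂G :=
    integral_mono (i1.sub (i2.const_mul _)) (integrable_diff G hh hv) fun y =>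
      prod_diff_ge_sq (fun i => h (y i)) (fun i => v (y i)) c hc
        (fun i => hh.2 _) (fun i => hv.2 _) (fun i => hle _) (fun i => hcv _)
  rw [integral_sub i1 (i2.const_mul _), integral_const_mul, h2, h2'] at h3
  nlinarith

lemma J_one {k : ℕ} (G : Measure (Fin k → ℝ)) [IsProbabilityMeasure G] (γ : Measure ℝ)
    (hk : k ≠ 0)
    (hm : ∀ i : Fin k, G.map (fun y => y i) = γ) {v T w : ℝ → ℝ} (b : ℝ)
    (hT : Nice T) (hv : Nice v) (hw : Nice w) (hb : ∀ y, v y ≤ b) (hle : ∀ y, v y + w y ≤ T y) :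
    J k G v + (1 - b * k) * ∫ y, w y ∂γ ≤ J k G T := by
  obtain ⟨k, rfl⟩ := Nat.exists_eq_succ_of_ne_zero hk
  have hwb : ∀ x, |w x| ≤ 1 := fun x => abs_le.2 ⟨by linarith [(hw.2 x).1], (hw.2 x).2⟩
  have h1 := J_sub G hv hT
  have h2 := integral_coord G γ hm w hw.1 0
  have h3 : ∫ y, (1 - b * ((k+1 : ℕ) : ℝ)) * w (y 0) ∂G ≤
      ∫ y, ((∏ i, (1 - v (y i))) - ∏ i, (1 - T (y i))) ∂G :=
    integral_mono ((integrable_coord G w hw.1 1 hwb 0).const_mul _) (integrable_diff G hv hT)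
      fun y => prod_diff_one (fun i => v (y i)) (fun i => T (y i)) (fun i => w (y i)) b
        (fun i => hv.2 _) (fun i => hT.2 _) (fun i => (hw.2 _).1) (fun i => hb _) (fun i => hle _)
  rw [integral_const_mul, h2] at h3
  simp only [Nat.succ_eq_add_one] at *
  linarith

lemma J_two {k : ℕ} (G : Measure (Fin k → ℝ)) [IsProbabilityMeasure G] (γ : Measure ℝ)
    (hk : 2 ≤ k)
    (hm : ∀ i : Fin k, G.map (fun y => y i) = γ) {h : ℝ → ℝ} (v : ℝ)
    (hh : Nice h) (hv : ∀ y, h y ≤ v) :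
    2 * (∫ y, h y ∂γ) - v ^ 2 ≤ J k G h := by
  obtain ⟨k, rfl⟩ := Nat.exists_eq_add_of_le' hk
  have hwb : ∀ x, |h x| ≤ 1 := fun x => abs_le.2 ⟨by linarith [(hh.2 x).1], (hh.2 x).2⟩
  have h2 := integral_coord G γ hm h hh.1 0
  have h2' := integral_coord G γ hm h hh.1 1
  have i0 := integrable_coord G h hh.1 1 hwb 0
  have i1 := integrable_coord G h hh.1 1 hwb 1
  have h3 : ∫ y, ((h (y 0) + h (y 1)) - v^2) ∂G ≤ J (k+2) G h := by
    refine integral_mono ((i0.add i1).sub (integrable_const _)) (hh.integrable_prod G) fun y => ?_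
    have hp := prod_one_sub_mem Finset.univ (fun i : Fin k => h (y i.succ.succ)) (fun i => hh.2 _)
    simp only at hp ⊢
    rw [Fin.prod_univ_succ, Fin.prod_univ_succ]
    have a0 := hh.2 (y 0)
    have a1 := hh.2 (y 1)
    have b0 := hv (y 0)
    have b1 := hv (y 1)
    have e : (Fin.succ 0 : Fin (k+2)) = 1 := rfl
    rw [e]
    set P := ∏ i : Fin k, (1 - h (y i.succ.succ))
    have e1 : (1 - h (y 0)) * ((1 - h (y 1)) * P) ≤ (1 - h (y 0)) * ((1 - h (y 1))) := by
      have : (1 - h (y 1)) * P ≤ (1 - h (y 1)) :=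
        mul_le_of_le_one_right (by linarith [a1.2]) hp.2
      exact mul_le_mul_of_nonneg_left this (by linarith [a0.2])
    have e2 : h (y 0) * h (y 1) ≤ v * v := mul_le_mul b0 b1 a1.1 (a0.1.trans b0)
    nlinarith
  have h4 : ∫ y, ((h (y 0) + h (y 1)) - v^2) ∂G =
      (∫ y, h (y 0) ∂G) + (∫ y, h (y 1) ∂G) - ∫ y, v^2 ∂G := by
    rw [← integral_add i0 i1]
    exact integral_sub (i0.add i1) (integrable_const _)
  rw [h4, h2, h2'] at h3
  simp at h3
  linarith

/-- the data of one generation -/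
structure Gen (p : ℕ → ℝ) (G : (k : ℕ) → Measure (Fin k → ℝ)) (γ : Measure ℝ)
    (m₀ m₁ μ μ₂ : ℝ) : Prop where
  p0 : p 0 = 0
  pnn : ∀ k, 0 ≤ p k
  psum : HasSum p 1
  Gp : ∀ k, IsProbabilityMeasure (G k)
  γp : IsProbabilityMeasure γ
  marg : ∀ k (i : Fin k), (G k).map (fun y => y i) = γ
  hμ : HasSum (fun k : ℕ => (k:ℝ) * p k) μ
  hμ₂ : HasSum (fun k : ℕ => (k:ℝ)^2 * p k) μ₂
  hm₀ : 1 < m₀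
  hμ0 : m₀ ≤ μ
  hμ1 : μ₂ ≤ m₁

/-- the one-step operator -/
noncomputable def S (p : ℕ → ℝ) (G : (k : ℕ) → Measure (Fin k → ℝ)) (h : ℝ → ℝ) : ℝ :=
  ∑' k, p k * J k (G k) h

section
variable {p : ℕ → ℝ} {G : (k : ℕ) → Measure (Fin k → ℝ)} {γ : Measure ℝ} {m₀ m₁ μ μ₂ : ℝ}

lemma Gen.μ_le (D : Gen p G γ m₀ m₁ μ μ₂) : μ ≤ m₁ := by
  refine (hasSum_le (fun k => ?_) D.hμ D.hμ₂).trans D.hμ1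
  refine mul_le_mul_of_nonneg_right ?_ (D.pnn k)
  rcases Nat.eq_zero_or_pos k with rfl | hk
  · simp
  · have : (1:ℝ) ≤ k := by exact_mod_cast hk
    nlinarith

lemma Gen.hasSum_S (D : Gen p G γ m₀ m₁ μ μ₂) {h : ℝ → ℝ} (hh : Nice h) :
    HasSum (fun k => p k * J k (G k) h) (S p G h) := by
  refine Summable.hasSum (Summable.of_nonneg_of_le (fun k => ?_) (fun k => ?_) D.psum.summable)
  · have := D.Gp k
    exact mul_nonneg (D.pnn k) (J_mem (G k) hh).1
  · have := D.Gp k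
    exact mul_le_of_le_one_right (D.pnn k) (J_mem (G k) hh).2

lemma Gen.S_nonneg (D : Gen p G γ m₀ m₁ μ μ₂) {h : ℝ → ℝ} (hh : Nice h) : 0 ≤ S p G h :=
  (D.hasSum_S hh).nonneg fun k => by
    have := D.Gp k
    exact mul_nonneg (D.pnn k) (J_mem (G k) hh).1

lemma Gen.S_mono (D : Gen p G γ m₀ m₁ μ μ₂) {h v : ℝ → ℝ} (hh : Nice h) (hv : Nice v)
    (hle : ∀ y, h y ≤ v y) : S p G h ≤ S p G v :=
  hasSum_le (fun k => by
    have := D.Gp k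
    exact mul_le_mul_of_nonneg_left (J_mono (G k) hh hv hle) (D.pnn k))
    (D.hasSum_S hh) (D.hasSum_S hv)

lemma Gen.S_union (D : Gen p G γ m₀ m₁ μ μ₂) {h v w : ℝ → ℝ} (hh : Nice h) (hv : Nice v)
    (hw : Nice w) (hle : ∀ y, v y ≤ h y + w y) :
    S p G v ≤ S p G h + μ * ∫ y, w y ∂γ := by
  refine hasSum_le (fun k => ?_) (D.hasSum_S hv) ((D.hasSum_S hh).add (D.hμ.mul_right _))
  have := D.Gp k
  have := mul_le_mul_of_nonneg_left (J_union (G k) γ (D.marg k) hh hv hw hle) (D.pnn k)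
  linarith

lemma Gen.S_lower (D : Gen p G γ m₀ m₁ μ μ₂) {h v : ℝ → ℝ} (c : ℝ) (hc : 0 ≤ c)
    (hh : Nice h) (hv : Nice v) (hle : ∀ y, h y ≤ v y) (hcv : ∀ y, v y - h y ≤ c * v y) :
    S p G h + μ * (∫ y, (v y - h y) ∂γ) - c * m₁ * ∫ y, (v y)^2 ∂γ ≤ S p G v := by
  have := D.γp
  have h1 : S p G h + (μ * (∫ y, (v y - h y) ∂γ) - μ₂ * (c * ∫ y, (v y)^2 ∂γ)) ≤ S p G v := by
    refine hasSum_le (fun k => ?_) ((D.hasSum_S hh).add ((D.hμ.mul_right _).sub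
      (D.hμ₂.mul_right _))) (D.hasSum_S hv)
    have := D.Gp k
    have := mul_le_mul_of_nonneg_left (J_lower (G k) γ (D.marg k) c hc hh hv hle hcv) (D.pnn k)
    linarith
  have h2 : 0 ≤ c * ∫ y, (v y)^2 ∂γ := mul_nonneg hc (integral_nonneg fun y => sq_nonneg _)
  have h3 := mul_le_mul_of_nonneg_right D.hμ1 h2
  linarith

lemma Gen.S_one (D : Gen p G γ m₀ m₁ μ μ₂) {v T w : ℝ → ℝ} (b : ℝ)
    (hT : Nice T) (hv : Nice v) (hw : Nice w) (hb : ∀ y, v y ≤ b) (hle : ∀ y, v y + w y ≤ T y) :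
    S p G v + (1 - b * m₁) * ∫ y, w y ∂γ ≤ S p G T := by
  have := D.γp
  have h1 : S p G v + (1 * (∫ y, w y ∂γ) - μ * (b * ∫ y, w y ∂γ)) ≤ S p G T := by
    refine hasSum_le (fun k => ?_) ((D.hasSum_S hv).add ((D.psum.mul_right _).sub
      (D.hμ.mul_right _))) (D.hasSum_S hT)
    rcases eq_or_ne k 0 with rfl | hk
    · simp [D.p0]
    have := D.Gp k
    have := mul_le_mul_of_nonneg_left (J_one (G k) γ hk (D.marg k) b hT hv hw hb hle) (D.pnn k)
    linarith
  have hb0 : 0 ≤ b := (hv.2 0).1.trans (hb 0)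
  have h2 : 0 ≤ b * ∫ y, w y ∂γ := mul_nonneg hb0 (integral_nonneg fun y => (hw.2 y).1)
  have h3 := mul_le_mul_of_nonneg_right D.μ_le h2
  linarith

lemma Gen.S_two (D : Gen p G γ m₀ m₁ μ μ₂) {h : ℝ → ℝ} (v : ℝ)
    (hh : Nice h) (hv : ∀ y, h y ≤ v) (hI : v ^ 2 ≤ ∫ y, h y ∂γ) :
    (∫ y, h y ∂γ) + (m₀ - 1)^2 / (4 * m₁) * ((∫ y, h y ∂γ) - v^2) ≤ S p G h := by
  have := D.γp
  set I := ∫ y, h y ∂γ with hIdef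
  have hm1 : 0 < m₁ := by linarith [D.hm₀, D.hμ0, D.μ_le]
  set t := 2 * m₁ / (m₀ - 1) with ht
  have hm0 : 0 < m₀ - 1 := by linarith [D.hm₀]
  have htpos : 0 < t := by positivity
  have hdnn : 0 ≤ I - v^2 := by linarith
  -- weights  c_k = (k - 1 - k²/t)/t ≤ 1_{k ≥ 2}
  have h1 : 1 * I + (μ * ((I - v^2)/t) - 1 * ((I - v^2)/t) - μ₂ * ((I - v^2)/t/t)) ≤ S p G h := by
    refine hasSum_le (fun k => ?_) ((D.psum.mul_right _).add (((D.hμ.mul_right _).sub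
      (D.psum.mul_right _)).sub (D.hμ₂.mul_right _))) (D.hasSum_S hh)
    rcases eq_or_ne k 0 with rfl | hk
    · simp [D.p0]
    have := D.Gp k
    have e : p k * I + ((k:ℝ) * p k * ((I - v^2)/t) - p k * ((I - v^2)/t)
      - (k:ℝ)^2 * p k * ((I - v^2)/t/t)) =
        p k * (I + (I - v^2) * (((k:ℝ) - 1 - (k:ℝ)^2/t)/t)) := by
      ring
    rw [e]
    refine mul_le_mul_of_nonneg_left ?_ (D.pnn k)
    have hk1 : (1:ℝ) ≤ k := by exact_mod_cast Nat.one_le_iff_ne_zero.2 hk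
    rcases Nat.lt_or_ge k 2 with hk2 | hk2
    · have hkk : k = 1 := by omega
      subst hkk
      have hJ := J_one (G 1) γ hk (D.marg 1) (v := fun _ => 0) (w := h) 0 hh
        ⟨measurable_const, fun _ => by simp⟩ hh (fun _ => le_rfl) (fun y => by simp)
      have hz : J 1 (G 1) (fun _ => 0) = 0 := by simp [J]
      rw [hz] at hJ
      have : (I - v^2) * ((((1:ℕ):ℝ) - 1 - ((1:ℕ):ℝ)^2/t)/t) ≤ 0 := by
        refine mul_nonpos_of_nonneg_of_nonpos hdnn ?_
        have : 0 < 1 / t := by positivity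
        rw [div_le_iff₀ htpos]
        simp
        positivity
      simp only [zero_mul, sub_zero, one_mul, zero_add] at hJ
      linarith
    · have hJ := J_two (G k) γ hk2 (D.marg k) v hh hv
      have hc : ((k:ℝ) - 1 - (k:ℝ)^2/t)/t ≤ 1 := by
        rw [div_le_iff₀ htpos, one_mul]
        rcases le_or_gt (k:ℝ) t with hkt | hkt
        · have : 0 ≤ (k:ℝ)^2/t := by positivity
          linarith
        · have : (k:ℝ) ≤ (k:ℝ)^2/t := by
            rw [le_div_iff₀ htpos]; nlinarith
          linarith
      have := mul_le_mul_of_nonneg_left hc hdnn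
      linarith
  have h2 : (m₀ - 1)^2 / (4 * m₁) ≤ (μ - 1 - μ₂ / t)/t := by
    rw [le_div_iff₀ htpos]
    have e1 : (m₀ - 1)^2 / (4 * m₁) * t = (m₀ - 1)/2 := by
      rw [ht]; field_simp; norm_num
    have e2 : μ₂ / t ≤ (m₀ - 1)/2 := by
      rw [div_le_iff₀ htpos, ht]
      have : (m₀ - 1)/2 * (2 * m₁ / (m₀ - 1)) = m₁ := by field_simp
      rw [this]; exact D.hμ1
    rw [e1]; linarith [D.hμ0]
  have h3 := mul_le_mul_of_nonneg_right h2 hdnn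
  have e : (μ - 1 - μ₂ / t)/t * (I - v^2) = (μ * ((I - v^2)/t) - 1 * ((I - v^2)/t) - μ₂ * ((I - v^2)/t/t)) := by ring
  linarith

end

end BRW
namespace BRW

/-! ### Lyapunov step -/

lemma Nice.indicator {h : ℝ → ℝ} (hh : Nice h) {C : Set ℝ} (hC : MeasurableSet C) :
    Nice (C.indicator h) := by
  refine ⟨hh.1.indicator hC, fun y => ?_⟩
  by_cases hy : y ∈ C
  · simpa [hy] using hh.2 y
  · simp [hy]

lemma Nice.sq {h : ℝ → ℝ} (hh : Nice h) : Nice (fun y => (h y)^2) :=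
  ⟨hh.1.pow_const 2, fun y => ⟨sq_nonneg _, by nlinarith [(hh.2 y).1, (hh.2 y).2]⟩⟩

lemma nice_zero : Nice (fun _ => (0:ℝ)) := ⟨measurable_const, fun _ => by simp⟩

lemma S_zero (p : ℕ → ℝ) (G : (k : ℕ) → Measure (Fin k → ℝ)) : S p G (fun _ => 0) = 0 := by
  simp [S, J]

/-- uniform decay of the tail of the displacement -/
def Tail (γ : Measure ℝ) (M κ : ℝ) : Prop :=
  ∀ s, M ≤ s → γ (Ici s) ≤ ENNReal.ofReal κ * γ (Ioi (s - M))

lemma tail_shift {γ : Measure ℝ} [IsProbabilityMeasure γ] {M κ : ℝ} (hκ : 0 ≤ κ)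
    (hT : Tail γ M κ) {f : ℝ → ℝ} (hf : Nice f) (hmono : Monotone f) (h0 : ∀ y ≤ M, f y = 0) :
    ∫ y, f y ∂γ ≤ κ * ∫ y, f (y + M) ∂γ := by
  have hf' : Measurable (fun y => f (y + M)) := hf.1.comp (measurable_id.add_const M)
  have key : ∫⁻ y, ENNReal.ofReal (f y) ∂γ ≤
      ENNReal.ofReal κ * ∫⁻ y, ENNReal.ofReal (f (y + M)) ∂γ := by
    rw [lintegral_eq_lintegral_meas_lt γ (Eventually.of_forall fun y => (hf.2 y).1)
      hf.1.aemeasurable, lintegral_eq_lintegral_meas_lt γ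
      (Eventually.of_forall fun y => (hf.2 (y + M)).1) hf'.aemeasurable,
      ← lintegral_const_mul' _ _ ENNReal.ofReal_ne_top]
    refine setLIntegral_mono' measurableSet_Ioi fun t ht => ?_
    have ht : 0 < t := ht
    rcases Set.eq_empty_or_nonempty {a | t < f a} with he | hne
    · rw [he]; simp
    have hlb : ∀ a ∈ {a | t < f a}, M ≤ a := by
      intro a ha
      by_contra hcon
      push Not at hcon
      have : t < f a := ha
      rw [h0 a hcon.le] at this
      linarith
    have hbdd : BddBelow {a | t < f a} := ⟨M, hlb⟩
    have hs : M ≤ sInf {a | t < f a} := le_csInf hne hlb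
    calc γ {a | t < f a} ≤ γ (Ici (sInf {a | t < f a})) :=
          measure_mono fun a ha => csInf_le hbdd ha
      _ ≤ ENNReal.ofReal κ * γ (Ioi (sInf {a | t < f a} - M)) := hT _ hs
      _ ≤ ENNReal.ofReal κ * γ {a | t < f (a + M)} := by
          refine mul_le_mul_right (measure_mono fun a ha => ?_) _
          have ha : sInf {a | t < f a} < a + M := by
            have : sInf {a | t < f a} - M < a := ha
            linarith
          obtain ⟨b, hb, hba⟩ := exists_lt_of_csInf_lt hne ha
          exact lt_of_lt_of_le (show t < f b from hb) (hmono hba.le)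
  rw [integral_eq_lintegral_of_nonneg_ae (Eventually.of_forall fun y => (hf.2 y).1)
    hf.1.aestronglyMeasurable, integral_eq_lintegral_of_nonneg_ae
      (Eventually.of_forall fun y => (hf.2 (y + M)).1) hf'.aestronglyMeasurable]
  have hfin : ∫⁻ y, ENNReal.ofReal (f (y + M)) ∂γ ≠ ⊤ := by
    have : ∫⁻ y, ENNReal.ofReal (f (y + M)) ∂γ ≤ ∫⁻ y, 1 ∂γ :=
      lintegral_mono fun y => by
        rw [← ENNReal.ofReal_one]; exact ENNReal.ofReal_le_ofReal (hf.2 _).2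
    simp at this
    exact ne_top_of_le_ne_top ENNReal.one_ne_top this
  have := ENNReal.toReal_mono (ENNReal.mul_ne_top ENNReal.ofReal_ne_top hfin) key
  rwa [ENNReal.toReal_mul, ENNReal.toReal_ofReal hκ] at this

lemma tail_pow {γ : Measure ℝ} [IsProbabilityMeasure γ] {M κ : ℝ} (hκ : 0 ≤ κ) (hM : 0 < M)
    (hT : Tail γ M κ) (n : ℕ) : γ.real (Ioi (n * M)) ≤ κ ^ n := by
  induction n with
  | zero => simp
  | succ n ih =>
    have h1 := hT ((n+1 : ℕ) * M) (by
      have : (0:ℝ) ≤ n * M := by positivity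
      push_cast; linarith)
    have e : ((n+1 : ℕ):ℝ) * M - M = n * M := by push_cast; ring
    rw [e] at h1
    have h2 := ENNReal.toReal_mono (ENNReal.mul_ne_top ENNReal.ofReal_ne_top
      (measure_ne_top γ _)) h1
    rw [ENNReal.toReal_mul, ENNReal.toReal_ofReal hκ] at h2
    have h3 : γ.real (Ioi ((n+1 : ℕ) * M)) ≤ γ.real (Ici ((n+1 : ℕ) * M)) :=
      measureReal_mono Ioi_subset_Ici_self
    have h4 : γ.real (Ici ((n+1 : ℕ) * M)) ≤ κ * γ.real (Ioi (n * M)) := h2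
    calc _ ≤ κ * γ.real (Ioi (n * M)) := h3.trans h4
      _ ≤ κ * κ ^ n := mul_le_mul_of_nonneg_left ih hκ
      _ = κ ^ (n+1) := by ring

lemma integral_ind_const (γ : Measure ℝ) (C : Set ℝ) (hC : MeasurableSet C) (c : ℝ) :
    ∫ y, C.indicator (fun _ => c) y ∂γ = c * γ.real C := by
  rw [integral_indicator_const c hC]; simp [mul_comm]

lemma integrable_ind_const (γ : Measure ℝ) [IsProbabilityMeasure γ] (C : Set ℝ)
    (hC : MeasurableSet C) (c : ℝ) :
    Integrable (fun y => C.indicator (fun _ => c) y) γ :=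
  (integrable_const c).indicator hC

/-- Adding a far cell to the quadratic functional. -/
lemma quad_step {γ : Measure ℝ} [IsProbabilityMeasure γ] {M κ : ℝ} (hκ : 0 ≤ κ) (hM : 0 < M)
    (hT : Tail γ M κ) {h : ℝ → ℝ} (hh : Nice h) (C : Set ℝ) (hC : MeasurableSet C) (n : ℕ) (L : ℝ)
    (hL : 0 ≤ L) (hb : ∀ y ∈ C, (n+1 : ℕ) * M < y → h y ≤ 16 ^ (n+1) * L) :
    ∫ y, (C.indicator h y)^2 ∂γ ≤ ∫ y, ((Iic (((n+1 : ℕ) : ℝ) * M)).indicator h y)^2 ∂γ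
      + L^2 * (256 * κ)^(n+1) := by
  have h1 := tail_pow hκ hM hT (n+1)
  set s : ℝ := ((n+1 : ℕ) : ℝ) * M
  have h2 : ∫ y, (C.indicator h y)^2 ∂γ ≤ ∫ y, (((Iic s).indicator h y)^2
      + (Ioi s).indicator (fun _ => (16^(n+1) * L)^2) y) ∂γ := by
    refine integral_mono ((hh.indicator hC).sq.integrable γ)
      (((hh.indicator measurableSet_Iic).sq.integrable γ).add
      (integrable_ind_const γ _ measurableSet_Ioi _)) fun y => ?_
    simp only
    by_cases hy : y ≤ s
    · have e1 : (Iic s).indicator h y = h y := by simp [hy]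
      have e2 : (Ioi s).indicator (fun _ => (16^(n+1) * L)^2) y = 0 := by simp [hy]
      rw [e1, e2, add_zero]
      by_cases hyC : y ∈ C
      · simp [hyC]
      · simp [hyC]; positivity
    · push Not at hy
      have e1 : (Iic s).indicator h y = 0 := by simp [hy]
      have e2 : (Ioi s).indicator (fun _ => (16^(n+1) * L)^2) y = (16^(n+1) * L)^2 := by simp [hy]
      rw [e1, e2]
      by_cases hyC : y ∈ C
      · have := hb y hyC hy
        have h0 := (hh.2 y).1
        simp only [hyC, indicator_of_mem]
        nlinarith
      · simp only [hyC, not_false_eq_true, indicator_of_notMem]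
        nlinarith [sq_nonneg (16^(n+1) * L)]
  rw [integral_add ((hh.indicator measurableSet_Iic).sq.integrable γ)
    (integrable_ind_const γ _ measurableSet_Ioi _), integral_ind_const γ _ measurableSet_Ioi] at h2
  have h3 : (16^(n+1) * L)^2 * γ.real (Ioi s) ≤ (16^(n+1) * L)^2 * κ^(n+1) :=
    mul_le_mul_of_nonneg_left h1 (by positivity)
  have e : (16^(n+1) * L)^2 * κ^(n+1) = L^2 * (256 * κ)^(n+1) := by
    have : ((16:ℝ)^(n+1))^2 = 256^(n+1) := by rw [← pow_mul, mul_comm, pow_mul]; norm_num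
    rw [mul_pow, this, mul_pow]; ring
  linarith

lemma geom_bound (r : ℝ) (h0 : 0 ≤ r) (h1 : r ≤ 1/2) (n : ℕ) :
    ∑ i ∈ Finset.range n, r^(i+1) ≤ 2 * r - 2 * r^(n+1) := by
  induction n with
  | zero => simp
  | succ n ih =>
    rw [Finset.sum_range_succ]
    have : r^(n+1+1) = r^(n+1) * r := pow_succ _ _
    have h2 : 0 ≤ r^(n+1) := by positivity
    nlinarith

lemma quad_bound {γ : Measure ℝ} [IsProbabilityMeasure γ] {M κ : ℝ} (hκ : 0 ≤ κ) (hM : 0 < M)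
    (hT : Tail γ M κ) {h : ℝ → ℝ} (hh : Nice h) (hmono : Monotone h) (n : ℕ)
    (hg : ∀ i ≤ n, h (((i+1 : ℕ) : ℝ) * M) ≤ 16 ^ i * h M) :
    ∫ y, ((Iic (((n+1 : ℕ) : ℝ) * M)).indicator h y)^2 ∂γ ≤
      h M * (∫ y, (Iic M).indicator h y ∂γ)
        + (h M)^2 * ∑ i ∈ Finset.range n, (256 * κ)^(i+1) := by
  induction n with
  | zero =>
    simp only [zero_add, Nat.cast_one, one_mul, Finset.range_zero, Finset.sum_empty, mul_zero,
      add_zero]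
    rw [← integral_const_mul]
    refine integral_mono ((hh.indicator measurableSet_Iic).sq.integrable γ)
      (((hh.indicator measurableSet_Iic).integrable γ).const_mul _) fun y => ?_
    by_cases hy : y ≤ M
    · have := hmono hy
      have h0 := (hh.2 y).1
      simp [hy]
      nlinarith
    · simp [hy]
  | succ n ih =>
    have h1 := ih fun i hi => hg i (by omega)
    have h2 := quad_step hκ hM hT hh (Iic (((n+1+1 : ℕ) : ℝ) * M)) measurableSet_Iic n (h M)
      (hh.2 M).1 fun y hy _ => (hmono hy).trans (hg (n+1) le_rfl)
    rw [Finset.sum_range_succ]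
    linarith

section
variable {p : ℕ → ℝ} {G : (k : ℕ) → Measure (Fin k → ℝ)} {γ : Measure ℝ} {m₀ m₁ μ μ₂ : ℝ}

/-- the modified function on the core -/
noncomputable def vcore (h T : ℝ → ℝ) (ε : ℝ) (C : Set ℝ) : ℝ → ℝ :=
  C.indicator (fun y => h y + min (T y - h y) (ε * h y))

lemma nice_vcore {h T : ℝ → ℝ} (hh : Nice h) (hT : Nice T) (hle : ∀ y, h y ≤ T y) {ε : ℝ}
    (hε : 0 ≤ ε) {C : Set ℝ} (hC : MeasurableSet C) : Nice (vcore h T ε C) := by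
  refine Nice.indicator ⟨?_, fun y => ⟨?_, ?_⟩⟩ hC
  · exact hh.1.add ((hT.1.sub hh.1).min (hh.1.const_mul ε))
  · have : 0 ≤ min (T y - h y) (ε * h y) :=
      le_min (by linarith [hle y]) (mul_nonneg hε (hh.2 y).1)
    linarith [(hh.2 y).1]
  · have := min_le_left (T y - h y) (ε * h y)
    linarith [(hT.2 y).2]

lemma Gen.core (D : Gen p G γ m₀ m₁ μ μ₂) {h T : ℝ → ℝ} (hh : Nice h) (hT : Nice T)
    (hle : ∀ y, h y ≤ T y) {ε Λ : ℝ} (hε : 0 ≤ ε) (hε1 : ε ≤ 1) (hΛ : 0 ≤ Λ)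
    (hLy : ∀ y, h y + ε * h y * (1 - Λ * h y) ≤ T y)
    {C : Set ℝ} (hC : MeasurableSet C) :
    (1 + ε) * S p G h - ε * (Λ * μ + 4 * m₁) * (∫ y, (C.indicator h y)^2 ∂γ) ≤
      S p G (vcore h T ε C) + 2 * m₁ * ∫ y, Cᶜ.indicator h y ∂γ := by
  have := D.γp
  have hm1 : 0 < m₁ := by linarith [D.hm₀, D.hμ0, D.μ_le]
  have hμpos : 0 < μ := by linarith [D.hm₀, D.hμ0]
  have n0 := hh.indicator hC
  have n1 := hh.indicator hC.compl
  have nv := nice_vcore hh hT hle hε hC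
  have a1 : S p G h ≤ S p G (C.indicator h) + μ * ∫ y, Cᶜ.indicator h y ∂γ := by
    refine D.S_union n0 hh n1 fun y => ?_
    by_cases hy : y ∈ C <;> simp [hy]
  have a2 : S p G (C.indicator h) ≤ μ * ∫ y, C.indicator h y ∂γ := by
    have := D.S_union nice_zero n0 n0 (fun y => by simp)
    rwa [S_zero, zero_add] at this
  have hd : ∀ y, C.indicator h y ≤ vcore h T ε C y ∧
      vcore h T ε C y ≤ (1 + ε) * C.indicator h y ∧
      ε * C.indicator h y - ε * Λ * (C.indicator h y)^2 ≤ vcore h T ε C y - C.indicator h y := by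
    intro y
    unfold vcore
    by_cases hy : y ∈ C
    · simp only [hy, indicator_of_mem]
      have b1 : 0 ≤ min (T y - h y) (ε * h y) :=
        le_min (by linarith [hle y]) (mul_nonneg hε (hh.2 y).1)
      have b2 := min_le_right (T y - h y) (ε * h y)
      have b3 : ε * h y - ε * Λ * (h y)^2 ≤ min (T y - h y) (ε * h y) := by
        refine le_min ?_ ?_
        · have := hLy y; nlinarith
        · have : 0 ≤ ε * Λ * (h y)^2 := by positivity
          linarith
      refine ⟨by linarith, by linarith, by linarith⟩
    · simp [hy]
  have a3 := D.S_lower ε hε n0 nv (fun y => (hd y).1) (fun y => by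
    have h1 := (hd y).1
    have h2 := (hd y).2.1
    nlinarith)
  have a4 : ε * (∫ y, C.indicator h y ∂γ) - ε * Λ * (∫ y, (C.indicator h y)^2 ∂γ) ≤
      ∫ y, (vcore h T ε C y - C.indicator h y) ∂γ := by
    rw [← integral_const_mul, ← integral_const_mul, ← integral_sub
      ((n0.integrable γ).const_mul _) ((n0.sq.integrable γ).const_mul _)]
    exact integral_mono (((n0.integrable γ).const_mul _).sub ((n0.sq.integrable γ).const_mul _))
      ((nv.integrable γ).sub (n0.integrable γ)) fun y => (hd y).2.2
  have a5 : ∫ y, (vcore h T ε C y)^2 ∂γ ≤ 4 * ∫ y, (C.indicator h y)^2 ∂γ := by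
    rw [← integral_const_mul]
    refine integral_mono (nv.sq.integrable γ) ((n0.sq.integrable γ).const_mul _) fun y => ?_
    have h1 := (hd y).1
    have h2 := (hd y).2.1
    have h3 := (n0.2 y).1
    have h4 : vcore h T ε C y ≤ 2 * C.indicator h y := by nlinarith
    simp only
    nlinarith
  have hA : 0 ≤ ∫ y, Cᶜ.indicator h y ∂γ := integral_nonneg fun y => (n1.2 y).1
  set A := ∫ y, Cᶜ.indicator h y ∂γ
  set Q := ∫ y, (C.indicator h y)^2 ∂γ
  set I := ∫ y, C.indicator h y ∂γ
  have b1 : μ * A ≤ m₁ * A := mul_le_mul_of_nonneg_right D.μ_le hA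
  have b2 := mul_le_mul_of_nonneg_left a4 hμpos.le
  have b3 := mul_le_mul_of_nonneg_left a5 (mul_nonneg hε hm1.le)
  have b4 := mul_le_mul_of_nonneg_left a2 hε
  have b5 : (1 + ε) * S p G h ≤ (1 + ε) * (S p G (C.indicator h) + m₁ * A) :=
    mul_le_mul_of_nonneg_left (by linarith) (by linarith)
  have b6 : ε * (m₁ * A) ≤ 1 * (m₁ * A) :=
    mul_le_mul_of_nonneg_right hε1 (mul_nonneg hm1.le hA)
  nlinarith

lemma Gen.cut (D : Gen p G γ m₀ m₁ μ μ₂) {h T : ℝ → ℝ} (hh : Nice h) (hT : Nice T)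
    (hmono : Monotone h)
    (hle : ∀ y, h y ≤ T y) {ε M κ τ : ℝ} (hε : 0 ≤ ε) (hε1 : ε ≤ 1) (hM : 0 < M) (hκ : 0 ≤ κ)
    (hκ1 : 512 * κ ≤ 1) (hκ2 : 8 * m₁ * κ ≤ 1) (hτ : 0 < τ) (hτ1 : 32 * m₁ * τ ≤ 1)
    (hTail : Tail γ M κ) (hT1 : ∀ y, h (y + M) ≤ T y) (hL : h M < τ) :
    (∀ y, h y = 0) ∨ ∃ C : Set ℝ, MeasurableSet C ∧
      S p G (vcore h T ε C) + 2 * m₁ * (∫ y, Cᶜ.indicator h y ∂γ) - 2 * m₁ / τ^2 * (h M)^2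
        ≤ S p G T ∧
      ∫ y, (C.indicator h y)^2 ∂γ ≤
        h M * (∫ y, (Iic M).indicator h y ∂γ) + 512 * κ * (h M)^2 := by
  classical
  have := D.γp
  have hm1 : 0 < m₁ := by linarith [D.hm₀, D.hμ0, D.μ_le]
  have hL0 := (hh.2 M).1
  by_cases hex : ∃ n : ℕ, 16 * h (((n+1 : ℕ) : ℝ) * M) < h (((n+2 : ℕ) : ℝ) * M) ∨
      τ ≤ 16^(n+1) * h M
  swap
  · left
    push Not at hex
    have hLz : h M = 0 := by
      by_contra hne
      have hpos : 0 < h M := lt_of_le_of_ne hL0 (Ne.symm hne)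
      obtain ⟨n, hn⟩ := pow_unbounded_of_one_lt (τ / h M) (by norm_num : (1:ℝ) < 16)
      have h1 := (hex n).2
      rw [div_lt_iff₀ hpos] at hn
      rw [pow_succ] at h1
      have : 0 ≤ (16:ℝ)^n * h M := by positivity
      linarith
    have hz : ∀ n : ℕ, h (((n+1 : ℕ) : ℝ) * M) ≤ 0 := by
      intro n
      induction n with
      | zero => simp [hLz]
      | succ n ih => exact (hex n).1.trans (by linarith)
    intro y
    obtain ⟨n, hn⟩ := exists_nat_ge (y / M)
    rw [div_le_iff₀ hM] at hn
    refine le_antisymm ((hmono (hn.trans ?_)).trans (hz n)) (hh.2 y).1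
    push_cast; nlinarith
  right
  set n := Nat.find hex with hn
  have hP := Nat.find_spec hex
  have hlt : ∀ i < n, h (((i+2 : ℕ) : ℝ) * M) ≤ 16 * h (((i+1 : ℕ) : ℝ) * M) ∧
      16^(i+1) * h M < τ := fun i hi => by
    have := Nat.find_min hex hi
    push Not at this
    exact this
  rw [← hn] at hP
  have hg : ∀ i ≤ n, h (((i+1 : ℕ) : ℝ) * M) ≤ 16 ^ i * h M := by
    intro i
    induction i with
    | zero => intro _; simp
    | succ i ih =>
      intro hi
      have h1 := ih (by omega)
      have h2 := (hlt i (by omega)).1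
      have : (16:ℝ)^(i+1) = 16^i * 16 := pow_succ _ _
      calc _ ≤ _ := h2
        _ ≤ 16 * (16^i * h M) := by linarith
        _ = _ := by rw [this]; ring
  have hτn : 16^n * h M < τ := by
    rcases Nat.eq_zero_or_pos n with h0 | hpos
    · rw [h0]; simpa using hL
    · have := (hlt (n-1) (by omega)).2
      rwa [Nat.sub_add_cancel hpos] at this
  have hq := quad_bound hκ hM hTail hh hmono n hg
  have hr0 : 0 ≤ 256 * κ := by positivity
  have hgeo := geom_bound (256 * κ) hr0 (by linarith) (n+1)
  have hgeo2 : ∑ i ∈ Finset.range (n+1), (256 * κ)^(i+1) ≤ 512 * κ := by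
    have : 0 ≤ (256 * κ)^(n+1+1) := by positivity
    linarith
  have hgeo3 := mul_le_mul_of_nonneg_left hgeo2 (sq_nonneg (h M))
  rw [Finset.sum_range_succ] at hgeo3
  have hpn : 0 ≤ (h M)^2 * (256 * κ)^(n+1) := by positivity
  set a := h (((n+1 : ℕ) : ℝ) * M) with ha
  have ha0 : 0 ≤ a := (hh.2 _).1
  have haτ : a < τ := (hg n le_rfl).trans_lt hτn
  have hMn : M ≤ ((n+1 : ℕ) : ℝ) * M := by
    have : (0:ℝ) ≤ n * M := by positivity
    push_cast; linarith
  have hLa : h M ≤ a := hmono hMn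
  rcases hP with hjump | hbig
  · -- a jump
    have hC : MeasurableSet {y | h y ≤ 4 * a} := measurableSet_le hh.1 measurable_const
    refine ⟨{y | h y ≤ 4 * a}, hC, ?_, ?_⟩
    · set C := {y | h y ≤ 4 * a} with hCdef
      set f := Cᶜ.indicator h with hf
      have nf : Nice f := hh.indicator hC.compl
      have hfm : Monotone f := by
        intro y z hyz
        have := hmono hyz
        by_cases hy : h y ≤ 4 * a
        · have : f y = 0 := by simp [hf, hCdef, hy]
          rw [this]; exact (nf.2 z).1
        · have hz : ¬ h z ≤ 4 * a := by linarith
          have e1 : f y = h y := by simp [hf, hCdef, hy]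
          have e2 : f z = h z := by simp [hf, hCdef, hz]
          rw [e1, e2]; exact this
      have hf0 : ∀ y ≤ M, f y = 0 := by
        intro y hy
        have h1 := hmono hy
        have : h y ≤ 4 * a := by linarith
        simp [hf, hCdef, this]
      have hsh := tail_shift hκ hTail nf hfm hf0
      have nw : Nice (fun y => 1/2 * f (y + M)) :=
        ⟨(nf.1.comp (measurable_id.add_const M)).const_mul _, fun y =>
          ⟨by linarith [(nf.2 (y+M)).1], by linarith [(nf.2 (y+M)).2]⟩⟩
      have nv := nice_vcore hh hT hle hε hC
      have hv2 : ∀ y, vcore h T ε C y ≤ 2 * C.indicator h y := by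
        intro y
        unfold vcore
        by_cases hy : y ∈ C
        · simp only [hy, indicator_of_mem]
          have := min_le_right (T y - h y) (ε * h y)
          have h0 := (hh.2 y).1
          nlinarith
        · simp [hy]
      have hvb : ∀ y, vcore h T ε C y ≤ 8 * τ := by
        intro y
        refine (hv2 y).trans ?_
        by_cases hy : y ∈ C
        · have : h y ≤ 4 * a := hy
          simp only [hy, indicator_of_mem]
          linarith
        · simp only [hy, not_false_eq_true, indicator_of_notMem]
          linarith
      have hvT : ∀ y, vcore h T ε C y ≤ T y := by
        intro y
        unfold vcore
        by_cases hy : y ∈ C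
        · simp only [hy, indicator_of_mem]
          have := min_le_left (T y - h y) (ε * h y)
          linarith
        · simp only [hy, not_false_eq_true, indicator_of_notMem]
          exact (hT.2 y).1
      have hvw : ∀ y, vcore h T ε C y + 1/2 * f (y + M) ≤ T y := by
        intro y
        by_cases hy1 : h (y + M) ≤ 4 * a
        · have : f (y + M) = 0 := by simp [hf, hCdef, hy1]
          rw [this]; linarith [hvT y]
        · have e1 : f (y + M) = h (y + M) := by simp [hf, hCdef, hy1]
          push Not at hy1
          rw [e1]
          have hTy := hT1 y
          by_cases hy : y ∈ C
          · have h2 := hv2 y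
            simp only [hy, indicator_of_mem] at h2
            have h3 : h y ≤ 4 * a := hy
            rcases le_or_gt y (((n+1 : ℕ) : ℝ) * M) with hle' | hgt
            · have : h y ≤ a := hmono hle'
              linarith
            · have : h (((n+2 : ℕ) : ℝ) * M) ≤ h (y + M) := by
                apply hmono
                push_cast at hgt ⊢
                linarith
              linarith
          · have : vcore h T ε C y = 0 := by simp [vcore, hy]
            rw [this]
            linarith [(hh.2 (y+M)).1]
      have hone := D.S_one (8 * τ) hT nv nw hvb hvw
      rw [integral_const_mul] at hone
      have hW : 0 ≤ ∫ y, f (y + M) ∂γ := integral_nonneg fun y => (nf.2 _).1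
      set W := ∫ y, f (y + M) ∂γ
      have e1 : 2 * m₁ * (∫ y, f y ∂γ) ≤ 2 * m₁ * (κ * W) :=
        mul_le_mul_of_nonneg_left hsh (by positivity)
      have e2 : 8 * m₁ * κ * W ≤ 1 * W := mul_le_mul_of_nonneg_right hκ2 hW
      have e3 : 32 * m₁ * τ * W ≤ 1 * W := mul_le_mul_of_nonneg_right hτ1 hW
      have e4 : 0 ≤ 2 * m₁ / τ^2 * (h M)^2 := by positivity
      nlinarith
    · have := quad_step hκ hM hTail hh {y | h y ≤ 4 * a} hC n (h M) hL0 (fun y hy _ => by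
        have h1 : h y ≤ 4 * a := hy
        have h2 := hg n le_rfl
        have h3 : (16:ℝ)^(n+1) = 16^n * 16 := pow_succ _ _
        have h4 : 0 ≤ (16:ℝ)^n * h M := by positivity
        rw [h3]; linarith)
      linarith
  · refine ⟨Iic (((n+1 : ℕ) : ℝ) * M), measurableSet_Iic, ?_, ?_⟩
    · have nv := nice_vcore hh hT hle hε (measurableSet_Iic (a := ((n+1 : ℕ) : ℝ) * M))
      have hvT : ∀ y, vcore h T ε (Iic (((n+1 : ℕ) : ℝ) * M)) y ≤ T y := by
        intro y
        unfold vcore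
        by_cases hy : y ∈ Iic (((n+1 : ℕ) : ℝ) * M)
        · simp only [hy, indicator_of_mem]
          have := min_le_left (T y - h y) (ε * h y)
          linarith
        · simp only [hy, not_false_eq_true, indicator_of_notMem]
          exact (hT.2 y).1
      have h1 := D.S_mono nv hT hvT
      have h2 : ∫ y, (Iic (((n+1 : ℕ) : ℝ) * M))ᶜ.indicator h y ∂γ ≤ κ^(n+1) := by
        refine le_trans ?_ (tail_pow hκ hM hTail (n+1))
        have e := integral_ind_const γ (Ioi (((n+1 : ℕ) : ℝ) * M)) measurableSet_Ioi 1
        rw [one_mul] at e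
        rw [← e, compl_Iic]
        refine integral_mono ((hh.indicator measurableSet_Ioi).integrable γ)
          (integrable_ind_const γ _ measurableSet_Ioi 1) fun y => ?_
        exact indicator_le_indicator (hh.2 y).2
      have h3 : κ^(n+1) ≤ (h M)^2 / τ^2 := by
        have e1 : (256 * κ)^(n+1) ≤ 1 := pow_le_one₀ hr0 (by linarith)
        have e2 : τ^2 ≤ (16^(n+1) * h M)^2 := by
          exact pow_le_pow_left₀ hτ.le hbig 2
        have e3 : ((16:ℝ)^(n+1))^2 = 256^(n+1) := by
          rw [← pow_mul, mul_comm, pow_mul]; norm_num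
        rw [mul_pow, e3] at e2
        rw [mul_pow] at e1
        rw [le_div_iff₀ (by positivity)]
        have e4 : 0 ≤ κ^(n+1) := by positivity
        have e5 := mul_le_mul_of_nonneg_left e2 e4
        have e6 := mul_le_mul_of_nonneg_right e1 (sq_nonneg (h M))
        linarith
      have h4 := mul_le_mul_of_nonneg_left (h2.trans h3) (by positivity : 0 ≤ 2 * m₁)
      have h5 : 2 * m₁ * ((h M)^2 / τ^2) = 2 * m₁ / τ^2 * (h M)^2 := by ring
      linarith
    · linarith

end
end BRW
namespace BRW

lemma arith_step {β m₀ m₁ μ Λ C L I S Q : ℝ} (hβ : 0 < β) (hβ1 : β < 1)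
    (hβ3 : (1 + β)^3 ≤ (1 - β) * m₀) (hm₀ : 1 < m₀) (hμ : m₀ ≤ μ) (hm₁ : 0 < m₁)
    (hC : 0 ≤ C) (hΛ : 32 * m₁ + 4 * C ≤ β * Λ) (hL : 0 ≤ L) (hI : 0 ≤ I) (hS : 0 ≤ S)
    (hQ0 : 0 ≤ Q)
    (hm₁L : m₁ * L ≤ β / 8) (h1 : μ * (L * (1 - β/8)) - m₁ * L^2 ≤ (1 + β/2) * S)
    (h2 : μ * I - m₁ * (L * I) ≤ S) (hQ : Q ≤ L * I + β * L^2) :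
    (Λ * μ + 4 * m₁) * Q + C * L^2 ≤ Λ * S^2 := by
  have hμ1 : 1 < μ := by linarith
  have hΛ0 : 0 ≤ Λ := by
    have : 0 ≤ β * Λ := by linarith
    exact nonneg_of_mul_nonneg_right this hβ
  have a1 : m₁ * L^2 ≤ β/8 * (μ * L) := by
    have e1 : m₁ * L * L ≤ β/8 * L := mul_le_mul_of_nonneg_right hm₁L hL
    have e2 : β/8 * L ≤ β/8 * (μ * L) := mul_le_mul_of_nonneg_left (by nlinarith) (by linarith)
    nlinarith
  have a2 : μ * L ≤ (1 + β) * S := by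
    have e1 : (μ * L) * (1 - β/4) ≤ ((1 + β) * S) * (1 - β/4) := by
      have : (1 + β/2) * S ≤ (1 + β) * (1 - β/4) * S :=
        mul_le_mul_of_nonneg_right (by nlinarith) hS
      nlinarith
    exact le_of_mul_le_mul_right e1 (by linarith)
  have a3 : μ * I ≤ (1 + β) * S := by
    have e0 : m₁ * (L * I) ≤ β/8 * (μ * I) := by
      have e1 : m₁ * L * I ≤ β/8 * I := mul_le_mul_of_nonneg_right hm₁L hI
      have e2 : β/8 * I ≤ β/8 * (μ * I) := mul_le_mul_of_nonneg_left (by nlinarith) (by linarith)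
      nlinarith
    have e1 : (μ * I) * (1 - β/8) ≤ ((1 + β) * S) * (1 - β/8) := by
      have : 1 * S ≤ (1 + β) * (1 - β/8) * S :=
        mul_le_mul_of_nonneg_right (by nlinarith) hS
      nlinarith
    exact le_of_mul_le_mul_right e1 (by linarith)
  have hμL : 0 ≤ μ * L := by positivity
  have hμI : 0 ≤ μ * I := by positivity
  have hbS : 0 ≤ (1 + β) * S := by positivity
  have a4 : (μ * L) * (μ * I) ≤ ((1 + β) * S) * ((1 + β) * S) := mul_le_mul a2 a3 hμI hbS
  have a5 : (μ * L) * (μ * L) ≤ ((1 + β) * S) * ((1 + β) * S) := mul_le_mul a2 a2 hμL hbS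
  have a6 : μ * (μ * Q) ≤ μ * ((1 - β) * S^2) := by
    calc μ * (μ * Q) = μ^2 * Q := by ring
      _ ≤ μ^2 * (L * I + β * L^2) := mul_le_mul_of_nonneg_left hQ (by positivity)
      _ = (μ * L) * (μ * I) + β * ((μ * L) * (μ * L)) := by ring
      _ ≤ ((1 + β) * S) * ((1 + β) * S) + β * (((1 + β) * S) * ((1 + β) * S)) :=
          add_le_add a4 (mul_le_mul_of_nonneg_left a5 hβ.le)
      _ = (1 + β)^3 * S^2 := by ring
      _ ≤ ((1 - β) * m₀) * S^2 := mul_le_mul_of_nonneg_right hβ3 (sq_nonneg _)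
      _ ≤ ((1 - β) * μ) * S^2 := mul_le_mul_of_nonneg_right
          (mul_le_mul_of_nonneg_left hμ (by linarith)) (sq_nonneg _)
      _ = _ := by ring
  have a7 : μ * Q ≤ (1 - β) * S^2 := le_of_mul_le_mul_left a6 (by linarith)
  have a8 : Q ≤ S^2 := by
    have e1 : Q ≤ μ * Q := by nlinarith
    have e2 : (1 - β) * S^2 ≤ S^2 := by nlinarith [sq_nonneg S]
    linarith
  have a9 : L^2 ≤ 4 * S^2 := by
    have e1 : L ≤ 2 * S := by nlinarith
    nlinarith
  have b1 := mul_le_mul_of_nonneg_left a7 hΛ0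
  have b2 := mul_le_mul_of_nonneg_left a8 (by linarith : 0 ≤ 4 * m₁)
  have b3 := mul_le_mul_of_nonneg_left a9 hC
  have b4 := mul_le_mul_of_nonneg_right hΛ (sq_nonneg S)
  have b5 : 0 ≤ m₁ * S^2 := by positivity
  nlinarith

/-- the relations between the constants -/
structure Consts (m₀ m₁ β κ Λ : ℝ) : Prop where
  β0 : 0 < β
  β1 : β < 1
  β3 : (1 + β)^3 ≤ (1 - β) * m₀
  κ0 : 0 ≤ κ
  κ1 : 512 * κ ≤ β
  κ2 : 8 * m₁ * κ ≤ 1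
  Λ1 : 32 * m₁ + 4 * (2 * m₁ / (1 / (32 * m₁))^2 / (β/2)) ≤ β * Λ
  Λ2 : 128 * m₁ < Λ

lemma exists_consts (m₀ m₁ : ℝ) (h0 : 1 < m₀) (h1 : 0 < m₁) :
    ∃ β κ Λ, 0 < κ ∧ Consts m₀ m₁ β κ Λ := by
  have hβ0 : 0 < (m₀ - 1) / (m₀ + 7) := div_pos (by linarith) (by linarith)
  have hβ1 : (m₀ - 1) / (m₀ + 7) < 1 := by rw [div_lt_one (by linarith)]; linarith
  have hβe : (m₀ - 1) / (m₀ + 7) * (m₀ + 7) = m₀ - 1 := div_mul_cancel₀ _ (by linarith)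
  set β := (m₀ - 1) / (m₀ + 7)
  set κ := min (β / 512) (1 / (8 * m₁))
  have hκ : 0 < κ := lt_min (by positivity) (by positivity)
  set X := 32 * m₁ + 4 * (2 * m₁ / (1 / (32 * m₁))^2 / (β/2))
  refine ⟨β, κ, max (X / β) (128 * m₁ + 1), hκ, hβ0, hβ1, ?_, hκ.le, ?_, ?_, ?_, ?_⟩
  · have : (1 + β)^3 ≤ 1 + 7 * β := by nlinarith [mul_pos hβ0 hβ0, mul_pos (mul_pos hβ0 hβ0) hβ0]
    nlinarith
  · have := min_le_left (β / 512) (1 / (8 * m₁))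
    change κ ≤ _ at this
    linarith
  · have := min_le_right (β / 512) (1 / (8 * m₁))
    change κ ≤ _ at this
    rw [le_div_iff₀ (by positivity)] at this
    linarith
  · have := le_max_left (X / β) (128 * m₁ + 1)
    rw [div_le_iff₀ hβ0] at this
    change X ≤ β * _
    rw [mul_comm]; exact this
  · have := le_max_right (X / β) (128 * m₁ + 1)
    linarith

section
variable {p : ℕ → ℝ} {G : (k : ℕ) → Measure (Fin k → ℝ)} {γ : Measure ℝ} {m₀ m₁ μ μ₂ : ℝ}

lemma Gen.step (D : Gen p G γ m₀ m₁ μ μ₂) {β κ Λ : ℝ} (K : Consts m₀ m₁ β κ Λ)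
    {h T : ℝ → ℝ} (hh : Nice h) (hT : Nice T) (hmono : Monotone h) (hle : ∀ y, h y ≤ T y)
    {M B : ℝ} (hM : 0 < M) (hTail : Tail γ M κ) (hT1 : ∀ y, h (y + M) ≤ T y)
    (hLy : ∀ y, h y + β/2 * h y * (1 - Λ * h y) ≤ T y)
    (hB : 1 - β/8 ≤ γ.real (Ioi (-B))) (hTL : ∀ y, -B < y → h M ≤ T y) :
    S p G h + β/2 * S p G h * (1 - Λ * S p G h) ≤ S p G T := by
  have := D.γp
  have hm1 : 0 < m₁ := by linarith [D.hm₀, D.hμ0, D.μ_le]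
  have hμpos : 0 < μ := by linarith [D.hm₀, D.hμ0]
  have hS0 := D.S_nonneg hh
  have hSm := D.S_mono hh hT hle
  have hβ0 := K.β0
  have hβ1 := K.β1
  have hΛpos : 0 < Λ := by linarith [K.Λ2]
  set s := S p G h with hs
  by_cases hbig : 1 ≤ Λ * s
  · have : 0 ≤ β/2 * s * (Λ * s - 1) := mul_nonneg (by positivity) (by linarith)
    nlinarith
  push Not at hbig
  by_cases hgood : (1 + β/2) * s ≤ S p G T
  · have : 0 ≤ β/2 * s * (Λ * s) := by positivity
    nlinarith
  push Not at hgood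
  set L := h M with hL
  have hL0 : 0 ≤ L := (hh.2 M).1
  have hL1 : L ≤ 1 := (hh.2 M).2
  -- lower bounds through `L`
  have nw : Nice ((Ioi (-B)).indicator (fun _ => L)) :=
    Nice.indicator ⟨measurable_const, fun _ => ⟨hL0, hL1⟩⟩ measurableSet_Ioi
  have hwT : ∀ y, (Ioi (-B)).indicator (fun _ => L) y ≤ T y := by
    intro y
    by_cases hy : -B < y
    · simpa [hy] using hTL y hy
    · simpa [hy] using (hT.2 y).1
  have hwI := integral_ind_const γ (Ioi (-B)) measurableSet_Ioi L
  have hgL : L * (1 - β/8) ≤ L * γ.real (Ioi (-B)) := mul_le_mul_of_nonneg_left hB hL0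
  have c1 : L * (1 - β/8) ≤ S p G T := by
    have := D.S_one 0 hT nice_zero nw (fun _ => le_rfl) (fun y => by simpa using hwT y)
    rw [S_zero, hwI] at this
    linarith
  have hΛL : Λ * L < 4 := by
    have e1 : L * (1/2) ≤ L * (1 - β/8) := mul_le_mul_of_nonneg_left (by linarith) hL0
    have e2 : L ≤ 2 * ((1 + β/2) * s) := by linarith
    have e3 : 2 * ((1 + β/2) * s) ≤ 3 * s := by nlinarith
    have e4 : Λ * L ≤ Λ * (3 * s) := mul_le_mul_of_nonneg_left (by linarith) hΛpos.le
    linarith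
  have c2 : μ * (L * (1 - β/8)) - m₁ * L^2 ≤ (1 + β/2) * s := by
    have e1 := D.S_lower 1 zero_le_one nice_zero nw (fun y => (nw.2 y).1) (fun y => by simp)
    have e2 := D.S_mono nw hT hwT
    simp only [sub_zero] at e1
    rw [S_zero, hwI] at e1
    have e3 : ∫ y, ((Ioi (-B)).indicator (fun _ => L) y)^2 ∂γ ≤ L^2 := by
      have : ∫ y, ((Ioi (-B)).indicator (fun _ => L) y)^2 ∂γ ≤ ∫ y, L^2 ∂γ := by
        refine integral_mono (nw.sq.integrable γ) (integrable_const _) fun y => ?_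
        refine pow_le_pow_left₀ (nw.2 y).1 ?_ 2
        by_cases hy : -B < y <;> simp [hy, hL0]
      simpa using this
    have e4 := mul_le_mul_of_nonneg_left e3 hm1.le
    have e5 := mul_le_mul_of_nonneg_left hgL hμpos.le
    linarith
  have nI := hh.indicator (measurableSet_Iic (a := M))
  have hI0 : 0 ≤ ∫ y, (Iic M).indicator h y ∂γ := integral_nonneg fun y => (nI.2 y).1
  set I := ∫ y, (Iic M).indicator h y ∂γ with hI
  have c3 : μ * I - m₁ * (L * I) ≤ s := by
    have e1 := D.S_lower 1 zero_le_one nice_zero nI (fun y => (nI.2 y).1) (fun y => by simp)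
    have e2 := D.S_mono nI hh (fun y => indicator_le_self' (fun _ _ => (hh.2 _).1) y)
    simp only [sub_zero] at e1
    rw [S_zero] at e1
    have e3 : ∫ y, ((Iic M).indicator h y)^2 ∂γ ≤ L * I := by
      rw [hI, ← integral_const_mul]
      refine integral_mono (nI.sq.integrable γ) ((nI.integrable γ).const_mul _) fun y => ?_
      have h0 := (nI.2 y).1
      have h1 : (Iic M).indicator h y ≤ L := by
        by_cases hy : y ≤ M
        · simpa [hy] using hmono hy
        · simpa [hy] using hL0
      simp only
      nlinarith
    have e4 := mul_le_mul_of_nonneg_left e3 hm1.le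
    linarith
  have hm32 : 0 < 32 * m₁ := by positivity
  have hLτ : h M < 1 / (32 * m₁) := by
    rw [lt_div_iff₀ hm32]
    have e1 : 128 * m₁ * L ≤ Λ * L := mul_le_mul_of_nonneg_right K.Λ2.le hL0
    linarith
  have hm1L : m₁ * L ≤ β/8 := by
    have hX : 0 ≤ 4 * (2 * m₁ / (1 / (32 * m₁))^2 / (β/2)) := by positivity
    have e0 := K.Λ1
    have e1 : 32 * m₁ * L ≤ β * Λ * L := mul_le_mul_of_nonneg_right (by linarith) hL0
    have e2 : β * (Λ * L) ≤ β * 4 := mul_le_mul_of_nonneg_left hΛL.le hβ0.le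
    linarith
  rcases D.cut hh hT hmono hle (ε := β/2) (τ := 1 / (32 * m₁)) (by linarith) (by linarith) hM K.κ0
    (by linarith [K.κ1]) K.κ2 (by positivity) (by field_simp; rfl) hTail hT1 hLτ with hz | hcut
  · have : h = fun _ => 0 := funext hz
    have hs0 : s = 0 := by rw [hs, this, S_zero]
    rw [hs0] at hSm ⊢
    simpa using hSm
  obtain ⟨C, hC, hc1, hc2⟩ := hcut
  have hcore := D.core hh hT hle (ε := β/2) (Λ := Λ) (by linarith) (by linarith) hΛpos.le hLy hC
  have hQ0 : 0 ≤ ∫ y, (C.indicator h y)^2 ∂γ := integral_nonneg fun y => sq_nonneg _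
  set Q := ∫ y, (C.indicator h y)^2 ∂γ
  have hQ : Q ≤ L * I + β * L^2 := by
    have := mul_le_mul_of_nonneg_right K.κ1 (sq_nonneg L)
    linarith
  have har := arith_step (C := 2 * m₁ / (1 / (32 * m₁))^2 / (β/2)) hβ0 hβ1 K.β3 D.hm₀ D.hμ0 hm1
    (by positivity) K.Λ1 hL0 hI0 hS0 hQ0 hm1L c2 c3 hQ
  have har2 := mul_le_mul_of_nonneg_left har (by linarith : 0 ≤ β/2)
  have e : β/2 * (2 * m₁ / (1 / (32 * m₁))^2 / (β/2) * L^2) = 2 * m₁ / (1 / (32 * m₁))^2 * L^2 := by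
    field_simp
  rw [mul_add, e] at har2
  linarith

end

/-- a solution of the recursion with horizon `n` -/
structure RecF (p : ℕ → ℕ → ℝ) (G : ℕ → (k : ℕ) → Measure (Fin k → ℝ)) (n : ℕ)
    (u : ℕ → ℝ → ℝ) : Prop where
  mem : ∀ m ≤ n, ∀ x, u m x ∈ Icc (0:ℝ) 1
  anti : ∀ m ≤ n, Antitone (u m)
  top1 : ∀ x < 0, u n x = 1
  top0 : ∀ x, 0 ≤ x → u n x = 0
  hrec : ∀ m < n, ∀ x, u m x = S (p m) (G m) (fun y => u (m+1) (x - y))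

section
variable {p : ℕ → ℕ → ℝ} {G : ℕ → (k : ℕ) → Measure (Fin k → ℝ)} {γ : ℕ → Measure ℝ}
  {m₀ m₁ : ℝ} {μ μ₂ : ℕ → ℝ}

lemma RecF.nice {n : ℕ} {u : ℕ → ℝ → ℝ} (R : RecF p G n u) {m : ℕ} (hm : m ≤ n) (x : ℝ) :
    Nice (fun y => u m (x - y)) := by
  refine ⟨?_, fun y => R.mem m hm _⟩
  have : Monotone (fun y => u m (x - y)) := fun a b hab => R.anti m hm (by linarith)
  exact this.measurable

lemma RecF.lyap {n : ℕ} {u : ℕ → ℝ → ℝ} (R : RecF p G n u)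
    (D : ∀ m, Gen (p m) (G m) (γ m) m₀ m₁ (μ m) (μ₂ m)) {β κ Λ : ℝ} (K : Consts m₀ m₁ β κ Λ)
    {M B : ℝ} (hM : 0 < M) (hB0 : 0 < B) (hTail : ∀ m, Tail (γ m) M κ)
    (hB : ∀ m, 1 - β/8 ≤ (γ m).real (Ioi (-B))) (d : ℕ) :
    ∀ m, m + d = n → ∀ z, u m z + β/2 * u m z * (1 - Λ * u m z) ≤ u m (z - (M + B)) := by
  induction d with
  | zero =>
    intro m hm z
    have hmn : m = n := by omega
    subst hmn
    have hm1 : 0 < m₁ := by linarith [(D 0).hm₀, (D 0).hμ0, (D 0).μ_le]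
    rcases lt_or_ge z 0 with hz | hz
    · rw [R.top1 z hz, R.top1 _ (by linarith)]
      have h1 : 1 ≤ Λ := by linarith [K.Λ2, (D 0).hm₀, (D 0).hμ0, (D 0).μ_le]
      have := mul_nonneg K.β0.le (by linarith : 0 ≤ Λ - 1)
      nlinarith
    · rw [R.top0 z hz]
      simpa using (R.mem m le_rfl _).1
  | succ d ih =>
    intro m hm z
    have hmn : m < n := by omega
    have ih' := ih (m+1) (by omega)
    rw [R.hrec m hmn z, R.hrec m hmn (z - (M + B))]
    have hA := R.anti (m+1) (by omega)
    refine (D m).step K (R.nice (by omega) z) (R.nice (by omega) _) ?_ ?_ hM (hTail m) ?_ ?_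
      (hB m) ?_
    · intro a b hab
      exact hA (by linarith)
    · intro y; exact hA (by linarith)
    · intro y; exact hA (by linarith)
    · intro y
      have := ih' (z - y)
      have e : z - (M + B) - y = z - y - (M + B) := by ring
      rw [e]; exact this
    · intro y hy; exact hA (by linarith)

/-- climbing to a fixed level to the left -/
lemma climb_right {f : ℝ → ℝ} (hf : Antitone f) {ε Λ M : ℝ} (hε : 0 < ε) (hΛ : 0 < Λ) (hM : 0 < M)
    (hLy : ∀ z, f z + ε * f z * (1 - Λ * f z) ≤ f (z - M)) (δ : ℝ) (hδ : 0 < δ) (z : ℝ)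
    (hz : δ ≤ f z) (N : ℕ) :
    min (1 / (2 * Λ)) ((1 + ε/2)^N * δ) ≤ f (z - N * M) := by
  induction N with
  | zero => simpa using Or.inr hz
  | succ N ih =>
    have hl := hLy (z - N * M)
    have e : z - (N+1 : ℕ) * M = z - N * M - M := by push_cast; ring
    rw [e]
    have han : f (z - N * M) ≤ f (z - N * M - M) := hf (by linarith)
    rcases le_or_gt (1 / (2 * Λ)) (f (z - N * M)) with h1 | h1
    · exact (min_le_left _ _).trans (h1.trans han)
    · have h2 : (1 + ε/2)^N * δ ≤ f (z - N * M) := by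
        rcases min_le_iff.1 ih with h | h
        · linarith
        · exact h
      refine (min_le_right _ _).trans ?_
      have hpos : 0 < (1 + ε/2)^N * δ := by positivity
      rw [lt_div_iff₀ (by positivity)] at h1
      set a := f (z - N * M)
      have h3 : (1 + ε/2) * a ≤ f (z - N * M - M) := by
        have : 0 ≤ ε * a * (1/2 - Λ * a) := mul_nonneg (by nlinarith) (by linarith)
        nlinarith
      calc (1 + ε/2)^(N+1) * δ = (1 + ε/2) * ((1 + ε/2)^N * δ) := by ring
        _ ≤ (1 + ε/2) * a := mul_le_mul_of_nonneg_left h2 (by linarith)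
        _ ≤ _ := h3

lemma down (D : ∀ m, Gen (p m) (G m) (γ m) m₀ m₁ (μ m) (μ₂ m))
    (hU : ∀ η : ℝ, 0 < η → ∃ B : ℝ, 0 < B ∧ ∀ m, (γ m).real (Ioi B) ≤ η)
    (δ : ℝ) (hδ : 0 < δ) (J : ℕ) :
    ∃ B : ℝ, 0 ≤ B ∧ ∃ δ' : ℝ, 0 < δ' ∧ ∀ n u, RecF p G n u → ∀ i ≤ J, i ≤ n → ∀ x,
      δ ≤ u 0 x → δ' ≤ u i (x - B) := by
  have hm1 : 0 < m₁ := by linarith [(D 0).hm₀, (D 0).hμ0, (D 0).μ_le]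
  induction J with
  | zero =>
    refine ⟨0, le_rfl, δ, hδ, fun n u R i hi _ x hx => ?_⟩
    have : i = 0 := by omega
    subst this
    simpa using hx
  | succ J ih =>
    obtain ⟨B, hB0, δ', hδ', h⟩ := ih
    obtain ⟨B1, hB1, hη⟩ := hU (δ' / (2 * m₁)) (by positivity)
    refine ⟨B + B1, by linarith, min δ' (δ' / (2 * m₁)), lt_min hδ' (by positivity), ?_⟩
    intro n u R i hi hin x hx
    rcases Nat.lt_or_ge i (J+1) with hlt | hge
    · have h1 := h n u R i (by omega) hin x hx
      exact (min_le_left _ _).trans (h1.trans (R.anti i hin (by linarith)))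
    have hi' : i = J + 1 := by omega
    subst hi'
    refine (min_le_right _ _).trans ?_
    have h1 := h n u R J le_rfl (by omega) x hx
    rw [R.hrec J (by omega)] at h1
    have := (D J).γp
    have nh := R.nice (m := J+1) hin (x - B)
    have h2 := (D J).S_union nice_zero nh nh (fun y => by simp)
    rw [S_zero, zero_add] at h2
    have h3 : ∫ y, u (J+1) (x - B - y) ∂(γ J) ≤ u (J+1) (x - (B + B1)) + δ' / (2 * m₁) := by
      have e : ∫ y, u (J+1) (x - B - y) ∂(γ J) ≤
          ∫ y, (u (J+1) (x - (B + B1)) + (Ioi B1).indicator (fun _ => 1) y) ∂(γ J) := by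
        refine integral_mono (nh.integrable _) ((integrable_const _).add
          (integrable_ind_const _ _ measurableSet_Ioi 1)) fun y => ?_
        simp only
        by_cases hy : B1 < y
        · have h5 := (R.mem (J+1) hin (x - B - y)).2
          have h6 := (R.mem (J+1) hin (x - (B + B1))).1
          simp only [mem_Ioi, hy, indicator_of_mem]
          linarith
        · simp only [mem_Ioi, hy, not_false_eq_true, indicator_of_notMem, add_zero]
          push Not at hy
          exact R.anti (J+1) hin (by linarith)
      rw [integral_add (integrable_const _) (integrable_ind_const _ _ measurableSet_Ioi 1),
        integral_ind_const _ _ measurableSet_Ioi] at e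
      simp only [integral_const, probReal_univ, smul_eq_mul, one_mul] at e
      linarith [hη J]
    have h4 : 0 ≤ ∫ y, u (J+1) (x - B - y) ∂(γ J) := integral_nonneg fun y => (nh.2 y).1
    have h5 := mul_le_mul_of_nonneg_right (D J).μ_le h4
    have h6 := mul_le_mul_of_nonneg_left h3 hm1.le
    have h7 : m₁ * (δ' / (2 * m₁)) = δ' / 2 := by field_simp
    have h8 : δ' / 2 ≤ m₁ * u (J+1) (x - (B + B1)) := by
      rw [mul_add, h7] at h6; linarith
    rw [div_le_iff₀ (by positivity)]
    linarith

lemma climb_left (D : ∀ m, Gen (p m) (G m) (γ m) m₀ m₁ (μ m) (μ₂ m))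
    {δ η q η₁ B : ℝ} (hδ : 0 < δ) (hη : 0 < η) (hη2 : δ ≤ 1 - η)
    (hq : q = (m₀ - 1)^2 / (4 * m₁)) (hη₁η : η₁ ≤ η)
    (hη₁ : (1 + q) * η₁ ≤ q * δ * η / 2) (hη₁0 : 0 ≤ η₁)
    (hB : ∀ m, 1 - η₁ ≤ (γ m).real (Ioi (-B)))
    {n : ℕ} {u : ℕ → ℝ → ℝ} (R : RecF p G n u) (x v : ℝ) (hδv : δ ≤ v) (i : ℕ) :
    ∀ m, m + i ≤ n → v ≤ u (m + i) x →
      min (v + i * (q * δ * η / 2)) (1 - η) ≤ u m (x - i * B) := by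
  have hm1 : 0 < m₁ := by linarith [(D 0).hm₀, (D 0).hμ0, (D 0).μ_le]
  have hq0 : 0 ≤ q := by rw [hq]; positivity
  induction i with
  | zero =>
    intro m _ hv
    simp at hv ⊢
    exact Or.inl hv
  | succ i ih =>
    intro m hm hv
    have h1 := ih (m+1) (by omega) (by rwa [add_right_comm, add_assoc])
    rw [R.hrec m (by omega)]
    have := (D m).γp
    set c := q * δ * η / 2 with hc
    have hc0 : 0 ≤ c := by positivity
    set t := min (v + i * c) (1 - η) with ht
    have htδ : δ ≤ t := le_min (by have : 0 ≤ i * c := by positivity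
                                   linarith) hη2
    have ht1 : t ≤ 1 - η := min_le_right _ _
    have nw : Nice ((Ioi (-B)).indicator (fun _ => t)) :=
      Nice.indicator ⟨measurable_const, fun _ => ⟨by linarith, by linarith⟩⟩ measurableSet_Ioi
    have hwI := integral_ind_const (γ m) (Ioi (-B)) measurableSet_Ioi t
    have hle : S (p m) (G m) ((Ioi (-B)).indicator (fun _ => t)) ≤
        S (p m) (G m) (fun y => u (m+1) (x - (i+1 : ℕ) * B - y)) := by
      refine (D m).S_mono nw (R.nice (by omega) _) fun y => ?_
      by_cases hy : -B < y
      · simp only [mem_Ioi, hy, indicator_of_mem]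
        refine h1.trans (R.anti (m+1) (by omega) ?_)
        push_cast
        linarith
      · simp only [mem_Ioi, hy, not_false_eq_true, indicator_of_notMem]
        exact (R.mem (m+1) (by omega) _).1
    have hgt : t * (1 - η₁) ≤ t * (γ m).real (Ioi (-B)) :=
      mul_le_mul_of_nonneg_left (hB m) (by linarith)
    have hsq : t^2 ≤ t * (1 - η₁) := by nlinarith
    have h2 := (D m).S_two t nw (fun y => by
      by_cases hy : -B < y
      · simp [hy]
      · simp [hy]; linarith) (by rw [hwI]; linarith)
    rw [hwI, ← hq] at h2
    have h3 : t + c ≤ S (p m) (G m) ((Ioi (-B)).indicator (fun _ => t)) := by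
      set g := t * (γ m).real (Ioi (-B))
      have e1 : q * (t * (1 - η₁) - t^2) ≤ q * (g - t^2) :=
        mul_le_mul_of_nonneg_left (by linarith) hq0
      have e2 : q * (δ * η) ≤ q * (t * (1 - t)) :=
        mul_le_mul_of_nonneg_left (mul_le_mul htδ (by linarith) hη.le (by linarith)) hq0
      have e3 : t * ((1 + q) * η₁) ≤ 1 * ((1 + q) * η₁) :=
        mul_le_mul_of_nonneg_right (by linarith) (by positivity)
      nlinarith
    refine le_trans ?_ (h3.trans hle)
    rcases min_cases (v + i * c) (1 - η) with ⟨h4, _⟩ | ⟨h4, _⟩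
    · refine (min_le_left _ _).trans ?_
      rw [ht, h4]; push_cast; linarith
    · refine (min_le_right _ _).trans ?_
      rw [ht, h4]; linarith

theorem main (D : ∀ m, Gen (p m) (G m) (γ m) m₀ m₁ (μ m) (μ₂ m))
    (hU : ∀ η : ℝ, 0 < η → ∃ B : ℝ, 0 < B ∧ ∀ m, (γ m).real (Ioi B) ≤ η)
    (hV : ∀ η : ℝ, 0 < η → ∃ B : ℝ, 0 < B ∧ ∀ m, 1 - η ≤ (γ m).real (Ioi (-B)))
    (hTl : ∀ κ : ℝ, 0 < κ → ∃ M : ℝ, 0 < M ∧ ∀ m, Tail (γ m) M κ)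
    (δ η : ℝ) (hδ : 0 < δ) (hη : 0 < η) (hη1 : η < 1) :
    ∃ C : ℝ, 0 < C ∧ ∀ n u, RecF p G n u → ∀ x, δ ≤ u 0 x → 1 - η ≤ u 0 (x - C) := by
  have hm1 : 0 < m₁ := by linarith [(D 0).hm₀, (D 0).hμ0, (D 0).μ_le]
  have hm0 : 0 < m₀ - 1 := by linarith [(D 0).hm₀]
  obtain ⟨β, κ, Λ, hκ, K⟩ := exists_consts m₀ m₁ (D 0).hm₀ hm1
  obtain ⟨M1, hM1, hTail⟩ := hTl κ hκ
  obtain ⟨B0, hB0, hBB⟩ := hV (β/8) (by linarith [K.β0])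
  have hΛ : 0 < Λ := by linarith [K.Λ2]
  have hβ0 := K.β0
  obtain ⟨q, hq⟩ : ∃ q, q = (m₀ - 1)^2 / (4 * m₁) := ⟨_, rfl⟩
  have hq0 : 0 < q := by rw [hq]; positivity
  set δ₁ := min (1 / (2 * Λ)) (1 - η) with hδ₁
  have hδ₁0 : 0 < δ₁ := lt_min (by positivity) (by linarith)
  have hc0 : 0 < q * δ₁ * η / 2 := by positivity
  set η₁ := min η (q * δ₁ * η / 2 / (1 + q)) with hη₁
  have hη₁0 : 0 < η₁ := lt_min hη (by positivity)
  obtain ⟨B, hB, hBm⟩ := hV η₁ hη₁0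
  obtain ⟨J, hJ⟩ := exists_nat_ge (1 / (q * δ₁ * η / 2))
  rw [div_le_iff₀ hc0] at hJ
  obtain ⟨B', hB', δ', hδ', hdown⟩ := down D hU δ hδ J
  obtain ⟨N, hN⟩ := pow_unbounded_of_one_lt (1 / (2 * Λ) / δ') (by linarith : 1 < 1 + β/2/2)
  rw [div_lt_iff₀ hδ'] at hN
  have hη₁q : (1 + q) * η₁ ≤ q * δ₁ * η / 2 := by
    have := min_le_right η (q * δ₁ * η / 2 / (1 + q))
    rw [← hη₁, le_div_iff₀ (by linarith)] at this
    linarith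
  have hleft : ∀ n u, RecF p G n u → ∀ x v, δ₁ ≤ v → ∀ i, i ≤ n → v ≤ u i x →
      min (v + i * (q * δ₁ * η / 2)) (1 - η) ≤ u 0 (x - i * B) := by
    intro n u R x v hv i hi hvx
    exact climb_left D hδ₁0 hη (min_le_right _ _) hq (min_le_left _ _) hη₁q hη₁0.le hBm R x v hv i
      0 (by omega) (by simpa using hvx)
  refine ⟨B' + N * (M1 + B0) + J * B + 1, by positivity, ?_⟩
  intro n u R x hx
  have hNM : 0 ≤ N * (M1 + B0) := by positivity
  rcases le_or_gt J n with hJn | hJn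
  · have h1 := hdown n u R J le_rfl hJn x hx
    have hly := R.lyap D K hM1 hB0 hTail hBB (n - J) J (by omega)
    have h2 := climb_right (R.anti J hJn) (by linarith : 0 < β/2) hΛ (by linarith : 0 < M1 + B0)
      hly δ' hδ' _ h1 N
    rw [min_eq_left hN.le] at h2
    have h3 := hleft n u R _ δ₁ le_rfl J hJn ((min_le_left _ _).trans h2)
    rw [min_eq_right (by linarith)] at h3
    exact h3.trans (R.anti 0 (by omega) (by linarith))
  · have h1 := hdown n u R n hJn.le le_rfl x hx
    have hneg : x - B' < 0 := by
      by_contra hcon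
      push Not at hcon
      rw [R.top0 _ hcon] at h1
      linarith
    have h2 := R.top1 _ hneg
    have h3 := hleft n u R (x - B') 1 ((min_le_right _ _).trans (by linarith)) n le_rfl h2.ge
    have h4 : (0:ℝ) ≤ n * (q * δ₁ * η / 2) := by positivity
    rw [min_eq_right (by linarith)] at h3
    refine h3.trans (R.anti 0 (by omega) ?_)
    have : (n:ℝ) * B ≤ J * B := mul_le_mul_of_nonneg_right (by exact_mod_cast hJn.le) hB.le
    linarith

end
end BRW

namespace BRW

lemma S_bridge {p : ℕ → ℝ} {G : (k : ℕ) → Measure (Fin k → ℝ)} {γ : Measure ℝ}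
    {m₀ m₁ μ μ₂ : ℝ} (D : Gen p G γ m₀ m₁ μ μ₂) {h : ℝ → ℝ} (hh : Nice h) :
    1 - ∑' k : ℕ, p k * ∫ y : Fin k → ℝ, (∏ i, (1 - h (y i))) ∂(G k) = S p G h := by
  have h1 := D.psum.sub (D.hasSum_S hh)
  have h2 : ∀ k : ℕ, p k * ∫ y : Fin k → ℝ, (∏ i, (1 - h (y i))) ∂(G k)
      = p k - p k * J k (G k) h := by
    intro k
    have := D.Gp k
    have e : ∫ y : Fin k → ℝ, (∏ i, (1 - h (y i))) ∂(G k)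
        = ∫ y : Fin k → ℝ, (1 - (1 - ∏ i, (1 - h (y i)))) ∂(G k) := by
      congr 1; ext y; ring
    rw [e, integral_sub (integrable_const _) (hh.integrable_prod (G k))]
    simp [J]; ring
  simp only [h2]
  rw [h1.tsum_eq]; ring

end BRW

/-- Under assumptions (B1'), (MT0'), (MT1'), (MT2') and (GT'), the family
of recentered maxima distributions `{F_n(· − Med(F_n))}` is tight: for every `ε > 0`
there is `K > 0` such that for all `n`,
`F_n(Med(F_n)+K) − F_n(Med(F_n)−K) ≥ 1 − ε`. -/
theorem stmt_16
    (p : ℕ → ℕ → ℝ)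
    (G : (n : ℕ) → (k : ℕ) → Measure (Fin k → ℝ))
    (g : ℕ → ℕ → Measure ℝ)
    (hp0 : ∀ n, p n 0 = 0)
    (hpnonneg : ∀ n k, 0 ≤ p n k)
    (hpsum : ∀ n, HasSum (p n) 1)
    (hpmean : ∀ n, Summable (fun k : ℕ => (k : ℝ) * p n k))
    (hGprob : ∀ n k, IsProbabilityMeasure (G n k))
    (hgprob : ∀ n k, IsProbabilityMeasure (g n k))
    (hmarg : ∀ n k (i : Fin k), (G n k).map (fun y => y i) = g n k)
    (F : ℕ → ℕ → ℝ → ℝ)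
    (hF01 : ∀ n m, m ≤ n → ∀ x, F n m x ∈ Icc (0 : ℝ) 1)
    (hFanti : ∀ n m, m ≤ n → Antitone (F n m))
    (hFrc : ∀ n m, m ≤ n → ∀ x, ContinuousWithinAt (F n m) (Ici x) x)
    (hFn1 : ∀ n (x : ℝ), x < 0 → F n n x = 1)
    (hFn0 : ∀ n (x : ℝ), 0 ≤ x → F n n x = 0)
    (hrec : ∀ n m, m < n → ∀ x : ℝ,
      F n m x = 1 - ∑' k : ℕ, p m k *
        ∫ y : Fin k → ℝ, (∏ i, (1 - F n (m + 1) (x - y i))) ∂(G m k))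
    -- (B1')
    (m₀ m₁ : ℝ) (hm₀ : 1 < m₀)
    (hB1'a : ∀ n, m₀ < ∑' k : ℕ, (k : ℝ) * p n k)
    (hpsq : ∀ n, Summable (fun k : ℕ => (k : ℝ) ^ 2 * p n k))
    (hB1'b : ∀ n, ∑' k : ℕ, (k : ℝ) ^ 2 * p n k < m₁)
    -- (MT0'): the marginals do not depend on the number of offspring
    (g1 : ℕ → Measure ℝ) (hMT0 : ∀ n k, 1 ≤ k → g n k = g1 n)
    (gbar : ℕ → ℝ → ℝ) (hgbar : ∀ n x, gbar n x = ((g1 n) (Ioi x)).toReal)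
    -- (MT1')
    (ε₀ : ℝ) (hε₀pos : 0 < ε₀) (hε₀lt : ε₀ < min ((1 / 4) * Real.log m₀) 1)
    (hMT1 : ∀ n, 1 - ε₀ ≤ gbar n 0)
    -- (MT2')
    (a M₀ : ℝ) (ha : 0 < a) (hM₀ : 0 < M₀)
    (hMT2 : ∀ n, ∀ M x : ℝ, M₀ < M → 0 ≤ x →
      gbar n (x + M) ≤ Real.exp (-a * M) * gbar n x)
    -- (GT')
    (hGT : ∀ η₁ : ℝ, 0 < η₁ → ∃ B : ℝ, 0 < B ∧ ∀ n k, p n k ≠ 0 →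
      1 - η₁ ≤ ((G n k) {y | ∀ i, y i ≤ B}).toReal ∧ 1 - η₁ ≤ gbar n (-B))
    -- distribution of the maximum and its median
    (Fd : ℕ → ℝ → ℝ) (hFd : ∀ n x, Fd n x = 1 - F n 0 x)
    (hFdBot : ∀ n, Tendsto (Fd n) atBot (nhds 0))
    (hFdTop : ∀ n, Tendsto (Fd n) atTop (nhds 1))
    (Med : ℕ → ℝ) (hMed : ∀ n, Med n = sInf {x | 1 / 2 ≤ Fd n x}) :
    ∀ ε : ℝ, 0 < ε → ∃ K : ℝ, 0 < K ∧
      ∀ n, 1 - ε ≤ Fd n (Med n + K) - Fd n (Med n - K) := by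
  have hgp : ∀ n, IsProbabilityMeasure (g1 n) := fun n => hMT0 n 1 le_rfl ▸ hgprob n 1
  have D : ∀ n, BRW.Gen (p n) (G n) (g1 n) m₀ m₁ (∑' k : ℕ, (k : ℝ) * p n k)
      (∑' k : ℕ, (k : ℝ) ^ 2 * p n k) := fun n =>
    { p0 := hp0 n
      pnn := hpnonneg n
      psum := hpsum n
      Gp := hGprob n
      γp := hgp n
      marg := fun k i => (hmarg n k i).trans (hMT0 n k (by have := i.2; omega))
      hμ := (hpmean n).hasSum
      hμ₂ := (hpsq n).hasSum
      hm₀ := hm₀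
      hμ0 := (hB1'a n).le
      hμ1 := (hB1'b n).le }
  have hexp : ∀ κ : ℝ, 0 < κ → ∃ M, M₀ < M ∧ Real.exp (-a * M) ≤ κ := by
    intro κ hκ
    refine ⟨max (M₀ + 1) (-Real.log κ / a), by linarith [le_max_left (M₀ + 1) (-Real.log κ / a)], ?_⟩
    have := le_max_right (M₀ + 1) (-Real.log κ / a)
    rw [div_le_iff₀ ha] at this
    rw [← Real.le_log_iff_exp_le hκ]
    linarith
  have hreal : ∀ n x, gbar n x = (g1 n).real (Ioi x) := fun n x => hgbar n x
  have hU : ∀ η : ℝ, 0 < η → ∃ B, 0 < B ∧ ∀ m, (g1 m).real (Ioi B) ≤ η := by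
    intro η hη
    obtain ⟨M, hM, hMe⟩ := hexp η hη
    refine ⟨M, hM₀.trans hM, fun m => ?_⟩
    have := hgp m
    have h1 := hMT2 m M 0 hM le_rfl
    rw [zero_add, hreal, hreal] at h1
    have h2 : (g1 m).real (Ioi 0) ≤ 1 := measureReal_le_one
    have h3 := mul_le_of_le_one_right (Real.exp_pos (-a * M)).le h2
    linarith
  have hV : ∀ η : ℝ, 0 < η → ∃ B, 0 < B ∧ ∀ m, 1 - η ≤ (g1 m).real (Ioi (-B)) := by
    intro η hη
    obtain ⟨B, hB, h⟩ := hGT η hη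
    refine ⟨B, hB, fun m => ?_⟩
    obtain ⟨k, hk⟩ : ∃ k, p m k ≠ 0 := by
      by_contra! hc
      have h0 : p m = fun _ => 0 := funext hc
      have h1 := hpsum m
      rw [h0] at h1
      exact zero_ne_one (hasSum_zero.unique h1)
    rw [← hreal]
    exact (h m k hk).2
  have hTl : ∀ κ : ℝ, 0 < κ → ∃ M, 0 < M ∧ ∀ m, BRW.Tail (g1 m) M κ := by
    intro κ hκ
    obtain ⟨M, hM, hMe⟩ := hexp κ hκ
    refine ⟨M + 1, by linarith, fun m s hs => ?_⟩
    have := hgp m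
    have h1 := hMT2 m M (s - (M + 1)) hM (by linarith)
    rw [hreal, hreal] at h1
    have h2 : (g1 m).real (Ici s) ≤ (g1 m).real (Ioi (s - (M + 1) + M)) :=
      measureReal_mono (fun y hy => by
        have : s ≤ y := hy
        change s - (M + 1) + M < y
        linarith)
    have h3 : (g1 m).real (Ici s) ≤ κ * (g1 m).real (Ioi (s - (M + 1))) :=
      h2.trans (h1.trans (mul_le_mul_of_nonneg_right hMe measureReal_nonneg))
    rw [← ofReal_measureReal (μ := g1 m) (s := Ici s), ← ofReal_measureReal (μ := g1 m) (s := Ioi (s - (M + 1))),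
      ← ENNReal.ofReal_mul hκ.le]
    exact ENNReal.ofReal_le_ofReal h3
  have R : ∀ n, BRW.RecF p G n (F n) := by
    intro n
    refine ⟨fun m hm => hF01 n m hm, fun m hm => hFanti n m hm, hFn1 n, hFn0 n, ?_⟩
    intro m hm x
    have hmo : Monotone (fun y => F n (m + 1) (x - y)) :=
      fun y z hyz => hFanti n (m + 1) hm (by linarith)
    rw [hrec n m hm x]
    exact BRW.S_bridge (D m) (h := fun y => F n (m + 1) (x - y))
      ⟨hmo.measurable, fun y => hF01 n (m + 1) hm _⟩
  intro ε hε
  obtain ⟨C, hC, hmain⟩ := BRW.main D hU hV hTl (min (ε / 2) (1 / 4)) (min (ε / 2) (1 / 4))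
    (lt_min (by linarith) (by norm_num)) (lt_min (by linarith) (by norm_num))
    ((min_le_right _ _).trans_lt (by norm_num))
  have hd1 := min_le_left (ε / 2) (1 / 4)
  have hd2 := min_le_right (ε / 2) (1 / 4)
  refine ⟨C + 1, by linarith, fun n => ?_⟩
  have hmono : Monotone (Fd n) := by
    intro x y hxy
    rw [hFd, hFd]
    linarith [hFanti n 0 (Nat.zero_le n) hxy]
  have hne : {x | 1 / 2 ≤ Fd n x}.Nonempty := by
    obtain ⟨x, hx⟩ := ((hFdTop n).eventually (lt_mem_nhds (by norm_num : (1 / 2 : ℝ) < 1))).exists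
    exact ⟨x, hx.le⟩
  have hbd : BddBelow {x | 1 / 2 ≤ Fd n x} := by
    obtain ⟨x, hx⟩ := ((hFdBot n).eventually (gt_mem_nhds (by norm_num : (0 : ℝ) < 1 / 2))).exists
    refine ⟨x, fun y hy => ?_⟩
    by_contra! hc
    have h1 : 1 / 2 ≤ Fd n y := hy
    have h2 := hmono hc.le
    linarith
  have hup : 1 / 2 ≤ Fd n (Med n + 1) := by
    obtain ⟨x, hx, hlt⟩ := exists_lt_of_csInf_lt hne
      (by rw [← hMed n]; linarith : sInf {x | 1 / 2 ≤ Fd n x} < Med n + 1)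
    exact le_trans hx (hmono hlt.le)
  have hdn : Fd n (Med n - 1) < 1 / 2 := by
    have := notMem_of_lt_csInf
      (by rw [← hMed n]; linarith : Med n - 1 < sInf {x | 1 / 2 ≤ Fd n x}) hbd
    exact not_le.1 this
  have hleft := hmain n (F n) (R n) (Med n - 1) (by have := hFd n (Med n - 1); linarith)
  have hright : F n 0 (Med n + (C + 1)) < min (ε / 2) (1 / 4) := by
    by_contra! hc
    have h1 := hmain n (F n) (R n) _ hc
    have e : Med n + (C + 1) - C = Med n + 1 := by ring
    rw [e] at h1
    have := hFd n (Med n + 1)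
    linarith
  have e : Med n - 1 - C = Med n - (C + 1) := by ring
  rw [e] at hleft
  rw [hFd, hFd]
  linarith
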